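/- The center Z of the quantum group g_{p₊,p₋} is a finite-dimensional ℂ-vector space of dimension (3p₊ − 1)(3p₋ − 1)/2. -/

import Mathlib

noncomputable section

/-- Generators of the quantum group `g_{p₊,p₋}`. -/
inductive QGGen : Type
  | Ep | Fp | Em | Fm | K

open FreeAlgebra QGGen

/-- `q = exp(iπ/p)`. -/
def rootOfUnity (p : ℕ) : ℂ := Complex.exp (Real.pi * Complex.I / p)

/-- The defining relations of the quantum group `g_{p₊,p₋}`. -/
inductive QGRel (pp pm : ℕ) : FreeAlgebra ℂ QGGen → FreeAlgebra ℂ QGGen → Prop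
  | EpNil : QGRel pp pm (ι ℂ Ep ^ pp) 0
  | FpNil : QGRel pp pm (ι ℂ Fp ^ pp) 0
  | EmNil : QGRel pp pm (ι ℂ Em ^ pm) 0
  | FmNil : QGRel pp pm (ι ℂ Fm ^ pm) 0
  | KOrd : QGRel pp pm (ι ℂ K ^ (2 * pp * pm)) 1
  | KEp : QGRel pp pm (ι ℂ K * ι ℂ Ep)
      (algebraMap ℂ (FreeAlgebra ℂ QGGen) ((rootOfUnity pp) ^ 2) * (ι ℂ Ep * ι ℂ K))
  | KFp : QGRel pp pm (ι ℂ K * ι ℂ Fp)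
      (algebraMap ℂ (FreeAlgebra ℂ QGGen) (((rootOfUnity pp) ^ 2)⁻¹) * (ι ℂ Fp * ι ℂ K))
  | KEm : QGRel pp pm (ι ℂ K * ι ℂ Em)
      (algebraMap ℂ (FreeAlgebra ℂ QGGen) ((rootOfUnity pm) ^ 2) * (ι ℂ Em * ι ℂ K))
  | KFm : QGRel pp pm (ι ℂ K * ι ℂ Fm)
      (algebraMap ℂ (FreeAlgebra ℂ QGGen) (((rootOfUnity pm) ^ 2)⁻¹) * (ι ℂ Fm * ι ℂ K))
  | EpEm : QGRel pp pm (ι ℂ Ep * ι ℂ Em) (ι ℂ Em * ι ℂ Ep)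
  | FpFm : QGRel pp pm (ι ℂ Fp * ι ℂ Fm) (ι ℂ Fm * ι ℂ Fp)
  | EpFm : QGRel pp pm (ι ℂ Ep * ι ℂ Fm) (ι ℂ Fm * ι ℂ Ep)
  | EmFp : QGRel pp pm (ι ℂ Em * ι ℂ Fp) (ι ℂ Fp * ι ℂ Em)
  | EpFp : QGRel pp pm (ι ℂ Ep * ι ℂ Fp - ι ℂ Fp * ι ℂ Ep)
      (algebraMap ℂ (FreeAlgebra ℂ QGGen)
          (((rootOfUnity pp) ^ pm - ((rootOfUnity pp) ^ pm)⁻¹)⁻¹) *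
        (ι ℂ K ^ pm - ι ℂ K ^ (2 * pp * pm - pm)))
  | EmFm : QGRel pp pm (ι ℂ Em * ι ℂ Fm - ι ℂ Fm * ι ℂ Em)
      (algebraMap ℂ (FreeAlgebra ℂ QGGen)
          (((rootOfUnity pm) ^ pp - ((rootOfUnity pm) ^ pp)⁻¹)⁻¹) *
        (ι ℂ K ^ pp - ι ℂ K ^ (2 * pp * pm - pp)))

/-- The quantum group `g_{p₊,p₋}`. -/
abbrev QG (pp pm : ℕ) : Type := RingQuot (QGRel pp pm)

open Polynomial
open scoped TensorProduct

/-- Over a field, the center of `A ⊗ B` is the tensor product of the centers. -/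
theorem exists_centerTensorEquiv (k A B : Type*) [Field k] [Ring A] [Ring B] [Algebra k A]
    [Algebra k B] :
    Nonempty ((Subalgebra.center k A ⊗[k] Subalgebra.center k B) ≃ₗ[k]
      Subalgebra.center k (A ⊗[k] B)) := by
  let f : (Subalgebra.center k A ⊗[k] Subalgebra.center k B) →ₐ[k] A ⊗[k] B :=
    Algebra.TensorProduct.map (Subalgebra.center k A).val (Subalgebra.center k B).val
  let g : (Subalgebra.center k A ⊗[k] B) →ₐ[k] A ⊗[k] B :=
    Algebra.TensorProduct.map (Subalgebra.center k A).val (AlgHom.id k B)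
  have hg : Function.Injective g := by
    have := Module.Flat.rTensor_preserves_injective_linearMap (M := B)
      (Subalgebra.center k A).val.toLinearMap Subtype.val_injective
    exact this
  have hfinj : Function.Injective f := by
    have := TensorProduct.map_injective_of_flat_flat
      (Subalgebra.center k A).val.toLinearMap (Subalgebra.center k B).val.toLinearMap
      Subtype.val_injective Subtype.val_injective
    exact this
  have hrange : LinearMap.range f.toLinearMap =
      Subalgebra.toSubmodule (Subalgebra.center k (A ⊗[k] B)) := by
    apply le_antisymm
    · rintro _ ⟨x, rfl⟩
      induction x using TensorProduct.induction_on with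
      | zero => simp
      | add x y hx hy => rw [map_add]; exact add_mem hx hy
      | tmul a b =>
        have : f (a ⊗ₜ b) = ((a : A) ⊗ₜ[k] (1 : B)) * ((1 : A) ⊗ₜ[k] (b : B)) := by
          simp [f]
        change f (a ⊗ₜ b) ∈ Subalgebra.center k (A ⊗[k] B)
        rw [this]
        refine mul_mem ?_ ?_
        · exact Algebra.TensorProduct.includeLeft_map_center_le k A B ⟨a, a.2, rfl⟩
        · exact Algebra.TensorProduct.includeRight_map_center_le k A B ⟨b, b.2, rfl⟩
    · intro z hz
      have hz' : ∀ y, y * z = z * y := (Subalgebra.mem_center_iff (R := k)).1 hz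
      have h1 : z ∈ g.range := by
        have := Subalgebra.centralizer_coe_range_includeLeft_eq_center_tensorProduct k A B
        rw [← this, Subalgebra.mem_centralizer_iff]
        exact fun y _ => hz' y
      obtain ⟨w, rfl⟩ := h1
      have h2 : w ∈ (Algebra.TensorProduct.map (AlgHom.id k (Subalgebra.center k A))
          (Subalgebra.center k B).val).range := by
        rw [← Subalgebra.centralizer_range_includeRight_eq_center_tensorProduct,
          Subalgebra.mem_centralizer_iff]
        intro y _
        apply hg
        rw [map_mul, map_mul]
        exact hz' _
      obtain ⟨v, rfl⟩ := h2
      refine ⟨v, ?_⟩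
      change f v = g (Algebra.TensorProduct.map (AlgHom.id k (Subalgebra.center k A))
          (Subalgebra.center k B).val v)
      rw [← AlgHom.comp_apply]
      congr 1
      ext <;> simp [f, g]
  exact ⟨(LinearEquiv.ofInjective f.toLinearMap hfinj).trans (LinearEquiv.ofEq _ _ hrange)⟩

/-- An algebra isomorphism restricts to the centers. -/
theorem exists_centerEquiv {k A B : Type*} [Field k] [Ring A] [Ring B] [Algebra k A]
    [Algebra k B] (e : A ≃ₐ[k] B) :
    Nonempty (Subalgebra.center k A ≃ₗ[k] Subalgebra.center k B) := by
  have h : (Subalgebra.center k A).map e.toAlgHom = Subalgebra.center k B := by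
    ext y
    simp only [Subalgebra.mem_map, Subalgebra.mem_center_iff]
    constructor
    · rintro ⟨x, hx, rfl⟩ b
      obtain ⟨a, rfl⟩ := e.surjective b
      have := congrArg e (hx a)
      simpa using this
    · intro hy
      refine ⟨e.symm y, fun b => ?_, by simp⟩
      apply e.injective
      simpa using hy (e b)
  let f : Subalgebra.center k A →ₗ[k] B :=
    e.toAlgHom.toLinearMap ∘ₗ (Subalgebra.center k A).val.toLinearMap
  have hf : Function.Injective f := fun x y hxy => Subtype.ext (e.injective hxy)
  have hr : LinearMap.range f = Subalgebra.toSubmodule (Subalgebra.center k B) := by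
    ext y
    rw [← h]
    constructor
    · rintro ⟨x, rfl⟩
      exact ⟨x, x.2, rfl⟩
    · rintro ⟨x, hx, rfl⟩
      exact ⟨⟨x, hx⟩, rfl⟩
  exact ⟨(LinearEquiv.ofInjective f hf).trans (LinearEquiv.ofEq _ _ hr)⟩

/-- The center of a product is the product of the centers. -/
theorem exists_centerProdEquiv (k A B : Type*) [Field k] [Ring A] [Ring B] [Algebra k A]
    [Algebra k B] :
    Nonempty (Subalgebra.center k (A × B) ≃ₗ[k]
      (Subalgebra.center k A × Subalgebra.center k B)) := by
  have h := Subalgebra.center_prod (R := k) (A := A) (B := B)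
  have hm : ∀ x : A × B, x ∈ Subalgebra.center k (A × B) ↔
      x.1 ∈ Subalgebra.center k A ∧ x.2 ∈ Subalgebra.center k B := by
    intro x; rw [h]; exact Subalgebra.mem_prod
  exact ⟨{ toFun := fun x => (⟨x.1.1, ((hm _).1 x.2).1⟩, ⟨x.1.2, ((hm _).1 x.2).2⟩)
           map_add' := fun x y => rfl
           map_smul' := fun x y => rfl
           invFun := fun x => ⟨(x.1.1, x.2.1), (hm _).2 ⟨x.1.2, x.2.2⟩⟩
           left_inv := fun x => rfl
           right_inv := fun x => rfl }⟩

theorem sum_smul_prod_erase_eq_zero_iff {ι : Type*} [Fintype ι] [DecidableEq ι] (c : ι → ℂ)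
    (a : ι → ℂ) :
    ∑ i, a i • ∏ j ∈ Finset.univ.erase i, (X - C (c j)) = 0 ↔
      ∀ v ∈ Finset.univ.image c, ∑ i with c i = v, a i = 0 := by
  set S := Finset.univ.image c with hS
  have hdvd : ∏ v ∈ S, (X - C v) ∣ ∏ i, (X - C (c i)) := by
    refine Finset.prod_dvd_of_coprime ?_ ?_
    · intro v _ w _ hvw
      exact isCoprime_X_sub_C_of_isUnit_sub (sub_ne_zero.2 hvw).isUnit
    · intro v hv
      obtain ⟨i, -, rfl⟩ := Finset.mem_image.1 hv
      exact Finset.dvd_prod_of_mem (fun i => X - C (c i)) (Finset.mem_univ i)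
  obtain ⟨N, hN⟩ := hdvd
  have hN0 : N ≠ 0 := by
    rintro rfl
    rw [mul_zero] at hN
    exact (monic_prod_of_monic Finset.univ (fun i => X - C (c i))
      fun i _ => monic_X_sub_C _).ne_zero hN
  have hP : ∀ i, ∏ j ∈ Finset.univ.erase i, (X - C (c j)) =
      N * ∏ w ∈ S.erase (c i), (X - C w) := by
    intro i
    have hx : (X - C (c i)) ≠ 0 := X_sub_C_ne_zero _
    apply mul_left_cancel₀ hx
    have h1 : (X - C (c i)) * ∏ j ∈ Finset.univ.erase i, (X - C (c j)) = ∏ j, (X - C (c j)) :=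
      Finset.mul_prod_erase _ (fun j => X - C (c j)) (Finset.mem_univ i)
    have h2 : (X - C (c i)) * ∏ w ∈ S.erase (c i), (X - C w) = ∏ w ∈ S, (X - C w) :=
      Finset.mul_prod_erase _ (fun w => X - C w) (by simp [hS])
    rw [h1, hN, ← h2]; ring
  have hsum : ∑ i, a i • ∏ j ∈ Finset.univ.erase i, (X - C (c j)) =
      N * ∑ v ∈ S, C (∑ i with c i = v, a i) * ∏ w ∈ S.erase v, (X - C w) := by
    rw [← Finset.sum_fiberwise_of_maps_to (s := Finset.univ) (t := S) (g := c)
      (fun i _ => by simp [hS]), Finset.mul_sum]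
    refine Finset.sum_congr rfl fun v _ => ?_
    rw [map_sum, Finset.sum_mul, Finset.mul_sum]
    refine Finset.sum_congr rfl fun i hi => ?_
    rw [hP, (Finset.mem_filter.1 hi).2, smul_eq_C_mul]
    ring
  rw [hsum, mul_eq_zero, or_iff_right hN0]
  constructor
  · intro h v hv
    have := congrArg (eval v) h
    rw [eval_finsetSum, Finset.sum_eq_single_of_mem v hv] at this
    · rw [eval_mul, eval_C, eval_zero, eval_prod, mul_eq_zero] at this
      refine this.resolve_right (Finset.prod_ne_zero_iff.2 fun w hw => ?_)
      simpa using sub_ne_zero.2 (Finset.ne_of_mem_erase hw).symm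
    · intro w hw hwv
      rw [eval_mul, eval_prod, Finset.prod_eq_zero (i := v)]
      · simp
      · exact Finset.mem_erase.2 ⟨hwv.symm, hv⟩
      · simp
  · intro h
    refine Finset.sum_eq_zero fun v hv => ?_
    rw [h v hv]; simp

/-- The linear map `a ↦ ∑ aᵢ ∏_{j ≠ i} (X - cⱼ)`. -/
def cofactorMap {ι : Type*} [Fintype ι] [DecidableEq ι] (c : ι → ℂ) : (ι → ℂ) →ₗ[ℂ] ℂ[X] where
  toFun a := ∑ i, a i • ∏ j ∈ Finset.univ.erase i, (X - C (c j))
  map_add' a b := by simp [add_smul, Finset.sum_add_distrib]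
  map_smul' r a := by simp [mul_smul, Finset.smul_sum]

theorem finrank_ker_cofactorMap {ι : Type*} [Fintype ι] [DecidableEq ι] (c : ι → ℂ) :
    Module.finrank ℂ (LinearMap.ker (cofactorMap c)) + (Finset.univ.image c).card =
      Fintype.card ι := by
  let L : (ι → ℂ) →ₗ[ℂ] (Finset.univ.image c → ℂ) :=
    { toFun := fun a v => ∑ i with c i = v, a i
      map_add' := fun a b => by ext; simp [Finset.sum_add_distrib]
      map_smul' := fun r a => by ext; simp [Finset.mul_sum] }
  have hker : LinearMap.ker (cofactorMap c) = LinearMap.ker L := by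
    ext a
    rw [LinearMap.mem_ker, LinearMap.mem_ker]
    refine (sum_smul_prod_erase_eq_zero_iff c a).trans ?_
    rw [funext_iff]
    exact ⟨fun h v => h v v.2, fun h v hv => h ⟨v, hv⟩⟩
  have hsurj : Function.Surjective L := by
    intro g
    have hex : ∀ v : Finset.univ.image c, ∃ i, c i = v := fun v => by
      simpa using Finset.mem_image.1 v.2
    choose s hs using hex
    refine ⟨fun i => if s ⟨c i, by simp⟩ = i then g ⟨c i, by simp⟩ else 0, ?_⟩
    ext v
    change (∑ i with c i = v, _) = _
    rw [Finset.sum_eq_single_of_mem (s v)]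
    · have : (⟨c (s v), by simp⟩ : Finset.univ.image c) = v := Subtype.ext (hs v)
      simp [this]
    · simp [hs]
    · intro i hi hne
      have : (⟨c i, by simp⟩ : Finset.univ.image c) = v :=
        Subtype.ext (Finset.mem_filter.1 hi).2
      rw [this, if_neg hne.symm]
  have := LinearMap.finrank_range_add_finrank_ker L
  rw [LinearMap.range_eq_top.2 hsurj, finrank_top] at this
  rw [hker]
  simp only [Module.finrank_fintype_fun_eq_card, Fintype.card_coe] at this
  omega

theorem two_mul_card_image_add_inv (s : Finset ℂ) (h0 : ∀ x ∈ s, x ≠ 0)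
    (hinv : ∀ x ∈ s, x⁻¹ ∈ s) :
    2 * (s.image fun x => x + x⁻¹).card = s.card + (s.filter fun x => x ^ 2 = 1).card := by
  have h1 := Finset.card_eq_sum_card_image (fun x : ℂ => x + x⁻¹) s
  have h2 : (s.filter fun x => x ^ 2 = 1).card = ∑ v ∈ s.image (fun x => x + x⁻¹),
      ((s.filter fun x => x ^ 2 = 1).filter fun x => x + x⁻¹ = v).card := by
    apply Finset.card_eq_sum_card_fiberwise
    intro x hx
    exact Finset.mem_coe.2 (Finset.mem_image_of_mem _ (Finset.mem_filter.1 hx).1)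
  rw [h1, h2, ← Finset.sum_add_distrib, mul_comm, ← smul_eq_mul, ← Finset.sum_const]
  refine Finset.sum_congr rfl fun v hv => ?_
  obtain ⟨x, hx, rfl⟩ := Finset.mem_image.1 hv
  have hx0 := h0 x hx
  have hfib : ∀ y, y ∈ s → (y + y⁻¹ = x + x⁻¹ ↔ y = x ∨ y = x⁻¹) := by
    intro y hy
    have hy0 := h0 y hy
    have : y + y⁻¹ - (x + x⁻¹) = (y - x) * (y - x⁻¹) * y⁻¹ := by field_simp; ring
    rw [← sub_eq_zero, this, mul_eq_zero, mul_eq_zero, sub_eq_zero, sub_eq_zero]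
    simp [hy0]
  have hset : (s.filter fun y => y + y⁻¹ = x + x⁻¹) = {x, x⁻¹} := by
    ext y
    simp only [Finset.mem_filter, Finset.mem_insert, Finset.mem_singleton]
    constructor
    · rintro ⟨hy, h⟩; exact (hfib y hy).1 h
    · rintro (rfl | rfl)
      · exact ⟨hx, rfl⟩
      · exact ⟨hinv _ hx, (hfib _ (hinv _ hx)).2 (Or.inr rfl)⟩
  rw [Finset.filter_comm, hset]
  by_cases h : x ^ 2 = 1
  · have hxi : x⁻¹ = x := inv_eq_of_mul_eq_one_left (by rw [← sq, h])
    rw [hxi, Finset.pair_eq_singleton, Finset.filter_singleton, if_pos h]; simp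
  · have hne : x ≠ x⁻¹ := fun he => h (by
      rw [sq]; nth_rewrite 2 [he]; exact mul_inv_cancel₀ hx0)
    rw [Finset.card_pair hne, Finset.filter_eq_empty_iff.2]
    · simp
    · intro y hy
      rcases Finset.mem_insert.1 hy with rfl | hy
      · exact h
      · rw [Finset.mem_singleton.1 hy, inv_pow]; simpa using h

/-- A cyclic system of `p` orthogonal idempotents in an algebra, with nilpotent raising and lowering
elements `E`, `F` whose commutator acts on the `i`-th idempotent by `cᵢ - cᵢ₋₁`. -/
structure CyclicRel {B : Type*} [Ring B] [Algebra ℂ B] (p : ℕ) [NeZero p] (c : ZMod p → ℂ)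
    (E F : B) (e : ZMod p → B) : Prop where
  E_pow : E ^ p = 0
  F_pow : F ^ p = 0
  e_mul : ∀ i j, e i * e j = if i = j then e i else 0
  sum_e : ∑ i, e i = 1
  E_e : ∀ i, E * e i = e (i + 1) * E
  F_e : ∀ i, F * e (i + 1) = e i * F
  comm_e : ∀ i, E * (F * e i) = F * (E * e i) + (c i - c (i - 1)) • e i

/-- The Casimir element. -/
def casimir {B : Type*} [Ring B] [Algebra ℂ B] {p : ℕ} [NeZero p] (c : ZMod p → ℂ)
    (E F : B) (e : ZMod p → B) : B :=
  F * E + ∑ i, c i • e i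

theorem commute_aeval {B : Type*} [Ring B] [Algebra ℂ B] {x y : B} (h : Commute x y)
    (f : Polynomial ℂ) : Commute (Polynomial.aeval x f) y := by
  induction f using Polynomial.induction_on' with
  | add f g hf hg => rw [map_add]; exact hf.add_left hg
  | monomial n a =>
    rw [Polynomial.aeval_monomial]
    exact Commute.mul_left (Algebra.commutes a y) (h.pow_left n)

@[to_additive]
theorem prod_range_natCast_add {M : Type*} [CommMonoid M] {p : ℕ} [NeZero p] (g : ZMod p → M)
    (i : ZMod p) : ∏ m ∈ Finset.range p, g (i + (m : ZMod p)) = ∏ j, g j := by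
  refine Finset.prod_bij (fun m _ => i + (m : ZMod p)) (by simp) ?_ ?_ (by simp)
  · intro a ha b hb hab
    have := add_left_cancel hab
    rw [ZMod.natCast_eq_natCast_iff] at this
    exact Nat.ModEq.eq_of_lt_of_lt this (Finset.mem_range.1 ha) (Finset.mem_range.1 hb)
  · intro j _
    refine ⟨(j - i).val, Finset.mem_range.2 (ZMod.val_lt _), ?_⟩
    simp

namespace CyclicRel

/-- The product of all `X - cⱼ` with `j ≠ i`. -/
def cofactor {p : ℕ} [NeZero p] (c : ZMod p → ℂ) (i : ZMod p) : ℂ[X] :=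
  ∏ j ∈ Finset.univ.erase i, (X - C (c j))

theorem cofactor_monic {p : ℕ} [NeZero p] (c : ZMod p → ℂ) (i : ZMod p) :
    (cofactor c i).Monic := monic_prod_of_monic _ _ fun _ _ => monic_X_sub_C _

theorem natDegree_cofactor {p : ℕ} [NeZero p] (c : ZMod p → ℂ) (i : ZMod p) :
    (cofactor c i).natDegree = p - 1 := by
  rw [cofactor, natDegree_prod_of_monic _ _ fun _ _ => monic_X_sub_C _]
  simp [Finset.card_erase_of_mem, ZMod.card]

theorem cofactor_eq_prod_range {p : ℕ} [NeZero p] (c : ZMod p → ℂ) (i : ZMod p) :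
    cofactor c i = ∏ m ∈ Finset.range (p - 1), (X - C (c (i + 1 + (m : ZMod p)))) := by
  apply mul_left_cancel₀ (X_sub_C_ne_zero (c i))
  rw [cofactor, Finset.mul_prod_erase _ (fun j => X - C (c j)) (Finset.mem_univ i),
    ← prod_range_natCast_add _ i]
  have hp : Finset.range p = Finset.range (p - 1 + 1) := by
    rw [Nat.sub_add_cancel (NeZero.pos p)]
  rw [hp, Finset.prod_range_succ', mul_comm]
  simp only [Nat.cast_zero, add_zero]
  congr 1
  refine Finset.prod_congr rfl fun m _ => ?_
  push_cast
  rw [show i + ((m : ZMod p) + 1) = i + 1 + m by ring]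

variable {B : Type*} [Ring B] [Algebra ℂ B] {p : ℕ} [NeZero p] {c : ZMod p → ℂ}
  {E F : B} {e : ZMod p → B}

theorem ext_e (h : CyclicRel p c E F e) {x y : B} (hxy : ∀ i, x * e i = y * e i) : x = y := by
  rw [← mul_one x, ← mul_one y, ← h.sum_e, Finset.mul_sum, Finset.mul_sum]
  exact Finset.sum_congr rfl fun i _ => hxy i

theorem e_self (h : CyclicRel p c E F e) (i : ZMod p) :
    e i * e i = e i := by rw [h.e_mul, if_pos rfl]

theorem sum_mul_e (h : CyclicRel p c E F e) {x : ZMod p → B} (i : ZMod p) :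
    (∑ j, x j * e j) * e i = x i * e i := by
  rw [Finset.sum_mul, Finset.sum_eq_single i]
  · rw [mul_assoc, h.e_self]
  · intro j _ hj; rw [mul_assoc, h.e_mul, if_neg hj, mul_zero]
  · simp

theorem casimir_mul_e (h : CyclicRel p c E F e) (i : ZMod p) :
    casimir c E F e * e i = F * (E * e i) + c i • e i := by
  rw [casimir, add_mul, mul_assoc]
  congr 1
  rw [Finset.sum_mul, Finset.sum_eq_single i]
  · rw [smul_mul_assoc, h.e_self]
  · intro j _ hj; rw [smul_mul_assoc, h.e_mul, if_neg hj, smul_zero]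
  · simp

theorem e_mul_casimir (h : CyclicRel p c E F e) (i : ZMod p) :
    e i * casimir c E F e = F * (E * e i) + c i • e i := by
  rw [casimir, mul_add, ← mul_assoc, ← h.F_e, mul_assoc, ← h.E_e]
  congr 1
  rw [Finset.mul_sum, Finset.sum_eq_single i]
  · rw [mul_smul_comm, h.e_self]
  · intro j _ hj; rw [mul_smul_comm, h.e_mul, if_neg hj.symm, smul_zero]
  · simp

theorem F_E_e (h : CyclicRel p c E F e) (i : ZMod p) :
    F * (E * e i) = casimir c E F e * e i - c i • e i := by
  rw [h.casimir_mul_e]; abel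

theorem E_F_e (h : CyclicRel p c E F e) (i : ZMod p) :
    E * (F * e i) = casimir c E F e * e i - c (i - 1) • e i := by
  rw [h.comm_e, h.casimir_mul_e, sub_smul]; abel

theorem commute_casimir_e (h : CyclicRel p c E F e) (i : ZMod p) :
    Commute (casimir c E F e) (e i) := by
  rw [Commute, SemiconjBy, h.casimir_mul_e, h.e_mul_casimir]

theorem F_e' (h : CyclicRel p c E F e) (i : ZMod p) : F * e i = e (i - 1) * F := by
  have := h.F_e (i - 1)
  rwa [sub_add_cancel] at this

theorem commute_casimir_E (h : CyclicRel p c E F e) : Commute (casimir c E F e) E := by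
  refine h.ext_e fun i => ?_
  have h1 : E * (F * e (i + 1)) * E = E * (F * (E * e i)) := by
    rw [h.E_e]; simp only [mul_assoc]
  have h2 := h.E_F_e (i + 1)
  rw [add_sub_cancel_right, eq_comm, sub_eq_iff_eq_add] at h2
  rw [mul_assoc, h.E_e, ← mul_assoc, h2, mul_assoc, h.casimir_mul_e, add_mul, h1, mul_add,
    mul_smul_comm, smul_mul_assoc, h.E_e]

theorem commute_casimir_F (h : CyclicRel p c E F e) : Commute (casimir c E F e) F := by
  refine h.ext_e fun i => ?_
  have h1 : F * (E * e (i - 1)) * F = F * (E * (F * e i)) := by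
    rw [h.F_e']; simp only [mul_assoc]
  rw [mul_assoc, h.F_e', ← mul_assoc, h.casimir_mul_e, mul_assoc, add_mul, h1, h.E_F_e,
    mul_sub, smul_mul_assoc, ← h.F_e', mul_smul_comm]
  abel

theorem E_pow_e (h : CyclicRel p c E F e) (n : ℕ) (i : ZMod p) :
    E ^ n * e i = e (i + n) * E ^ n := by
  induction n with
  | zero => simp
  | succ n ih =>
    rw [pow_succ', mul_assoc, ih, ← mul_assoc, h.E_e, mul_assoc]
    push_cast; rw [add_assoc]

theorem F_pow_e (h : CyclicRel p c E F e) (n : ℕ) (i : ZMod p) :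
    F ^ n * e i = e (i - n) * F ^ n := by
  induction n with
  | zero => simp
  | succ n ih =>
    rw [pow_succ', mul_assoc, ih, ← mul_assoc, h.F_e', mul_assoc]
    push_cast; rw [sub_sub]

theorem F_pow_E_pow_e (h : CyclicRel p c E F e) (n : ℕ) (i : ZMod p) : F ^ n * (E ^ n * e i) =
    aeval (casimir c E F e) (∏ m ∈ Finset.range n, (X - C (c (i + (m : ZMod p))))) * e i := by
  induction n with
  | zero => simp
  | succ n ih =>
    have h1 : F ^ (n + 1) * (E ^ (n + 1) * e i) = F ^ n * (F * (E * e (i + n))) * E ^ n := by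
      rw [pow_succ' E, mul_assoc, h.E_pow_e, pow_succ]; simp only [mul_assoc]
    have hc := h.commute_casimir_F.symm.pow_left n
    rw [h1, h.F_E_e, mul_sub, ← mul_assoc, hc.eq, sub_mul, mul_smul_comm, smul_mul_assoc,
      mul_assoc, mul_assoc, mul_assoc, ← h.E_pow_e, ih, Finset.prod_range_succ, mul_comm, map_mul,
      map_sub, aeval_X, aeval_C, sub_mul, sub_mul, Algebra.smul_def, mul_assoc, mul_assoc]

theorem aeval_prod_mul_e (h : CyclicRel p c E F e) (i : ZMod p) :
    aeval (casimir c E F e) (∏ j, (X - C (c j))) * e i = 0 := by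
  rw [← prod_range_natCast_add _ i, ← h.F_pow_E_pow_e, h.F_pow, zero_mul]

theorem aeval_cofactor_mul_e (h : CyclicRel p c E F e) (i : ZMod p) :
    aeval (casimir c E F e) (cofactor c i) * e (i + 1) =
    F ^ (p - 1) * (E ^ (p - 1) * e (i + 1)) := by
  rw [cofactor_eq_prod_range, ← h.F_pow_E_pow_e]

theorem aeval_cofactor_mul_E_e (h : CyclicRel p c E F e) (i : ZMod p) :
    aeval (casimir c E F e) (cofactor c i) * (E * e i) = 0 := by
  have hp : p - 1 + 1 = p := Nat.sub_add_cancel (NeZero.pos p)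
  rw [h.E_e, ← mul_assoc, h.aeval_cofactor_mul_e, mul_assoc, mul_assoc, ← h.E_e,
    ← mul_assoc (E ^ _), ← pow_succ, hp, h.E_pow, zero_mul, mul_zero]

theorem aeval_cofactor_mul_F_e (h : CyclicRel p c E F e) (i : ZMod p) :
    aeval (casimir c E F e) (cofactor c i) * (F * e (i + 1)) = 0 := by
  have hp : p - 1 + 1 = p := Nat.sub_add_cancel (NeZero.pos p)
  rw [← mul_assoc, (commute_aeval h.commute_casimir_F _).eq, mul_assoc, h.aeval_cofactor_mul_e,
    ← mul_assoc, ← pow_succ', hp, h.F_pow, zero_mul]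

theorem mem_span_of_mem_adjoin (h : CyclicRel p c E F e) {x : B}
    (hx : x ∈ Algebra.adjoin ℂ ({E, F} ∪ Set.range e)) :
    x ∈ Submodule.span ℂ {y : B | ∃ (f : ℂ[X]) (n : ℕ) (i : ZMod p),
      y = aeval (casimir c E F e) f * (E ^ n * e i) ∨
      y = aeval (casimir c E F e) f * (F ^ n * e i)} := by
  set W := Submodule.span ℂ {y : B | ∃ (f : ℂ[X]) (n : ℕ) (i : ZMod p),
      y = aeval (casimir c E F e) f * (E ^ n * e i) ∨
      y = aeval (casimir c E F e) f * (F ^ n * e i)} with hW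
  have key : ∀ w ∈ W, x * w ∈ W := by
    induction hx using Algebra.adjoin_induction with
    | algebraMap r =>
      intro w hw
      rw [← Algebra.smul_def]; exact W.smul_mem _ hw
    | add x y _ _ hx hy => intro w hw; rw [add_mul]; exact W.add_mem (hx w hw) (hy w hw)
    | mul x y _ _ hx hy => intro w hw; rw [mul_assoc]; exact hx _ (hy w hw)
    | mem x hx =>
      intro w hw
      induction hw using Submodule.span_induction with
      | zero => simp
      | add x y _ _ hx hy => rw [mul_add]; exact W.add_mem hx hy
      | smul r x _ hx => rw [mul_smul_comm]; exact W.smul_mem _ hx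
      | mem w hw =>
        obtain ⟨f, n, i, hw⟩ := hw
        have hE := (commute_aeval h.commute_casimir_E f).symm
        have hF := (commute_aeval h.commute_casimir_F f).symm
        have he := fun j => (commute_aeval (h.commute_casimir_e j) f).symm
        have hmul : ∀ (a : ℂ) y, aeval (casimir c E F e) f * (casimir c E F e * y - a • y) =
            aeval (casimir c E F e) (f * (X - C a)) * y := by
          intro a y
          rw [map_mul, map_sub, aeval_X, aeval_C, mul_assoc, sub_mul, Algebra.smul_def]
        rcases hx with (rfl | rfl) | ⟨j, rfl⟩
        · rcases hw with rfl | rfl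
          · refine Submodule.subset_span ⟨f, n + 1, i, Or.inl ?_⟩
            rw [← mul_assoc, hE.eq, mul_assoc, ← mul_assoc x, pow_succ']
          · cases n with
            | zero =>
              refine Submodule.subset_span ⟨f, 1, i, Or.inl ?_⟩
              rw [← mul_assoc, hE.eq, mul_assoc, pow_zero, one_mul, pow_one]
            | succ n =>
              refine Submodule.subset_span ⟨f * (X - C (c (i - n - 1))), n, i, Or.inr ?_⟩
              rw [← hmul, ← mul_assoc, hE.eq, mul_assoc, pow_succ', mul_assoc F, h.F_pow_e,
                ← mul_assoc F, ← mul_assoc x, h.E_F_e, sub_mul, smul_mul_assoc, mul_assoc]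
        · rcases hw with rfl | rfl
          · cases n with
            | zero =>
              refine Submodule.subset_span ⟨f, 1, i, Or.inr ?_⟩
              rw [← mul_assoc, hF.eq, mul_assoc, pow_zero, one_mul, pow_one]
            | succ n =>
              refine Submodule.subset_span ⟨f * (X - C (c (i + n))), n, i, Or.inl ?_⟩
              rw [← hmul, ← mul_assoc, hF.eq, mul_assoc, pow_succ', mul_assoc E, h.E_pow_e,
                ← mul_assoc E, ← mul_assoc x, h.F_E_e, sub_mul, smul_mul_assoc, mul_assoc]
          · refine Submodule.subset_span ⟨f, n + 1, i, Or.inr ?_⟩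
            rw [← mul_assoc, hF.eq, mul_assoc, ← mul_assoc x, pow_succ']
        · rcases hw with rfl | rfl
          · rw [← mul_assoc, (he j).eq, mul_assoc, h.E_pow_e, ← mul_assoc (e j), h.e_mul]
            split_ifs with hj
            · refine Submodule.subset_span ⟨f, n, i, Or.inl ?_⟩
              rw [hj, h.E_pow_e]
            · simp
          · rw [← mul_assoc, (he j).eq, mul_assoc, h.F_pow_e, ← mul_assoc (e j), h.e_mul]
            split_ifs with hj
            · refine Submodule.subset_span ⟨f, n, i, Or.inr ?_⟩
              rw [hj, h.F_pow_e]
            · simp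
  have h1 : (1 : B) ∈ W := by
    rw [← h.sum_e]
    exact W.sum_mem fun i _ => Submodule.subset_span ⟨1, 0, i, Or.inl (by simp)⟩
  simpa using key 1 h1

theorem exists_aeval_of_mem_adjoin (h : CyclicRel p c E F e) {x : B}
    (hx : x ∈ Algebra.adjoin ℂ ({E, F} ∪ Set.range e)) (i : ZMod p) :
    ∃ f : ℂ[X], f.degree < p ∧ e i * (x * e i) = aeval (casimir c E F e) f * e i := by
  have key : ∃ f : ℂ[X], e i * (x * e i) = aeval (casimir c E F e) f * e i := by
    have hx' := h.mem_span_of_mem_adjoin hx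
    clear hx
    induction hx' using Submodule.span_induction with
    | zero => exact ⟨0, by simp⟩
    | add x y _ _ hx hy =>
      obtain ⟨f, hf⟩ := hx
      obtain ⟨g, hg⟩ := hy
      exact ⟨f + g, by rw [add_mul, mul_add, hf, hg, map_add, add_mul]⟩
    | smul r x _ hx =>
      obtain ⟨f, hf⟩ := hx
      exact ⟨r • f, by rw [smul_mul_assoc, mul_smul_comm, hf, map_smul, smul_mul_assoc]⟩
    | mem x hx =>
      obtain ⟨f, n, j, hx⟩ := hx
      have he := (commute_aeval (h.commute_casimir_e i) f).symm
      rcases Nat.eq_zero_or_pos n with rfl | hn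
      · refine ⟨if i = j then f else 0, ?_⟩
        have hx : x = aeval (casimir c E F e) f * e j := by simpa using hx
        rw [hx, ← mul_assoc, ← mul_assoc, he.eq, mul_assoc _ (e i), h.e_mul]
        split_ifs
        · rw [mul_assoc, h.e_self]
        · simp
      · by_cases hnp : (n : ZMod p) = 0
        · have hle : p ≤ n := Nat.le_of_dvd hn ((ZMod.natCast_eq_zero_iff n p).1 hnp)
          have hx0 : x = 0 := by
            rcases hx with rfl | rfl
            · rw [pow_eq_zero_of_le hle h.E_pow]; simp
            · rw [pow_eq_zero_of_le hle h.F_pow]; simp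
          exact ⟨0, by simp [hx0]⟩
        · refine ⟨0, ?_⟩
          rcases hx with rfl | rfl
          · rw [mul_assoc, mul_assoc, h.e_mul]
            split_ifs with hj
            · subst hj
              rw [← mul_assoc, he.eq, mul_assoc, h.E_pow_e, ← mul_assoc (e j), h.e_mul, if_neg]
              · simp
              · simpa using hnp
            · simp
          · rw [mul_assoc, mul_assoc, h.e_mul]
            split_ifs with hj
            · subst hj
              rw [← mul_assoc, he.eq, mul_assoc, h.F_pow_e, ← mul_assoc (e j), h.e_mul, if_neg]
              · simp
              · rw [eq_comm, sub_eq_self]; exact hnp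
            · simp
  obtain ⟨f, hf⟩ := key
  have hP : (∏ j, (X - C (c j))).Monic := monic_prod_of_monic _ _ fun _ _ => monic_X_sub_C _
  have hdeg : (∏ j, (X - C (c j))).degree = ((p : ℕ) : WithBot ℕ) := by
    rw [degree_eq_natDegree hP.ne_zero, natDegree_prod_of_monic _ _ fun _ _ => monic_X_sub_C _]
    simp [ZMod.card]
  refine ⟨f %ₘ ∏ j, (X - C (c j)), hdeg ▸ degree_modByMonic_lt f hP, ?_⟩
  rw [hf]
  conv_lhs => rw [← modByMonic_add_div f (∏ j, (X - C (c j)))]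
  rw [mul_comm, map_add, map_mul, add_mul, mul_assoc _ _ (e i), h.aeval_prod_mul_e, mul_zero,
    add_zero]

end CyclicRel

namespace CyclicRel

/-- The polynomial attached to the `i`-th idempotent by the central element with parameters
`(f, a)`. -/
def centralPoly {p : ℕ} [NeZero p] (c : ZMod p → ℂ) (f : ℂ[X]) (a : ZMod p → ℂ) (i : ZMod p) :
    ℂ[X] :=
  f + ∑ m ∈ Finset.range i.val, a (m : ZMod p) • cofactor c (m : ZMod p)

theorem centralPoly_zero {p : ℕ} [NeZero p] (c : ZMod p → ℂ) (f : ℂ[X]) (a : ZMod p → ℂ) :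
    centralPoly c f a 0 = f := by
  simp [centralPoly]

theorem centralPoly_add_one {p : ℕ} [NeZero p] (c : ZMod p → ℂ) (f : ℂ[X])
    (a : ZMod p → ℂ) (ha : ∑ i, a i • cofactor c i = 0) (i : ZMod p) :
    centralPoly c f a (i + 1) = centralPoly c f a i + a i • cofactor c i := by
  have hi : ((i.val : ℕ) : ZMod p) = i := ZMod.natCast_zmod_val i
  have hsucc : centralPoly c f a i + a i • cofactor c i =
      f + ∑ m ∈ Finset.range (i.val + 1), a (m : ZMod p) • cofactor c (m : ZMod p) := by
    rw [Finset.sum_range_succ, hi, centralPoly, add_assoc]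
  rw [hsucc]
  have hlt := ZMod.val_lt i
  have hi1 : ((i.val + 1 : ℕ) : ZMod p) = i + 1 := by push_cast; rw [hi]
  rcases Nat.lt_or_ge (i.val + 1) p with hl | hl
  · rw [centralPoly, ← hi1, ZMod.val_natCast_of_lt hl]
  · have hp : i.val + 1 = p := le_antisymm hlt hl
    have h0 : i + 1 = 0 := by rw [← hi1, hp]; simp
    have hs := sum_range_natCast_add (fun i => a i • cofactor c i) 0
    simp only [zero_add] at hs
    rw [h0, centralPoly_zero, hp, hs, ha, add_zero]

theorem degree_cofactor_lt {p : ℕ} [NeZero p] (c : ZMod p → ℂ) (i : ZMod p) :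
    (cofactor c i).degree < ((p : ℕ) : WithBot ℕ) := by
  rw [degree_eq_natDegree (cofactor_monic c i).ne_zero, natDegree_cofactor]
  exact_mod_cast Nat.sub_lt (NeZero.pos p) one_pos

theorem centralPoly_mem {p : ℕ} [NeZero p] (c : ZMod p → ℂ) (f : degreeLT ℂ p)
    (a : ZMod p → ℂ) (i : ZMod p) : centralPoly c f a i ∈ degreeLT ℂ p :=
  Submodule.add_mem _ f.2 (Submodule.sum_mem _ fun _ _ => Submodule.smul_mem _ _
    (mem_degreeLT.2 (degree_cofactor_lt c _)))

variable {B : Type*} [Ring B] [Algebra ℂ B] {p : ℕ} [NeZero p] {c : ZMod p → ℂ}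
  {E F : B} {e : ZMod p → B}

/-- The element with parameters `(f, a)`. -/
def centralMap (c : ZMod p → ℂ) (E F : B) (e : ZMod p → B) :
    (degreeLT ℂ p × LinearMap.ker (cofactorMap c)) →ₗ[ℂ] B where
  toFun x := ∑ i, aeval (casimir c E F e) (centralPoly c x.1 x.2 i) * e i
  map_add' x y := by
    rw [← Finset.sum_add_distrib]
    refine Finset.sum_congr rfl fun i _ => ?_
    rw [← add_mul, ← map_add]
    congr 2
    simp only [centralPoly, Prod.fst_add, Prod.snd_add, Submodule.coe_add, Pi.add_apply, add_smul,
      Finset.sum_add_distrib]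
    abel
  map_smul' r x := by
    simp only [RingHom.id_apply]
    rw [Finset.smul_sum]
    refine Finset.sum_congr rfl fun i _ => ?_
    rw [← smul_mul_assoc, ← map_smul]
    congr 2
    simp [centralPoly, smul_smul, smul_add, Finset.smul_sum]

theorem centralMap_mul_e (h : CyclicRel p c E F e)
    (x : degreeLT ℂ p × LinearMap.ker (cofactorMap c)) (i : ZMod p) :
    centralMap c E F e x * e i = aeval (casimir c E F e) (centralPoly c x.1 x.2 i) * e i :=
  h.sum_mul_e (x := fun i => aeval (casimir c E F e) (centralPoly c x.1 x.2 i)) i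

theorem centralMap_mem_center (h : CyclicRel p c E F e)
    (hgen : Algebra.adjoin ℂ ({E, F} ∪ Set.range e) = ⊤)
    (x : degreeLT ℂ p × LinearMap.ker (cofactorMap c)) :
    centralMap c E F e x ∈ Subalgebra.center ℂ B := by
  have hstep := centralPoly_add_one c x.1 x.2 x.2.2
  set z := centralMap c E F e x with hz
  have hze : ∀ i, z * e i = aeval (casimir c E F e) (centralPoly c x.1 x.2 i) * e i :=
    h.centralMap_mul_e x
  suffices hgens : ∀ y ∈ ({E, F} ∪ Set.range e : Set B), y * z = z * y by
    rw [Subalgebra.mem_center_iff]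
    intro y
    have hy : y ∈ Algebra.adjoin ℂ ({E, F} ∪ Set.range e) := hgen ▸ Algebra.mem_top
    induction hy using Algebra.adjoin_induction with
    | algebraMap r => exact Algebra.commutes r z
    | add u v _ _ hu hv => rw [add_mul, mul_add, hu, hv]
    | mul u v _ _ hu hv => rw [mul_assoc, hv, ← mul_assoc, hu, mul_assoc]
    | mem u hu => exact hgens u hu
  rintro y ((rfl | rfl) | ⟨j, rfl⟩)
  · refine h.ext_e fun i => ?_
    rw [mul_assoc, hze, mul_assoc, h.E_e, ← mul_assoc z, hze, mul_assoc, ← h.E_e, hstep, map_add,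
      add_mul, map_smul, smul_mul_assoc, h.aeval_cofactor_mul_E_e, smul_zero, add_zero,
      ← mul_assoc, ← (commute_aeval h.commute_casimir_E _).eq, mul_assoc]
  · refine h.ext_e fun i => ?_
    obtain ⟨i, rfl⟩ : ∃ j, i = j + 1 := ⟨i - 1, by ring⟩
    rw [mul_assoc, hze, mul_assoc, h.F_e, ← mul_assoc z, hze, mul_assoc, ← h.F_e, hstep,
      ← mul_assoc, ← (commute_aeval h.commute_casimir_F _).eq, mul_assoc, map_add,
      add_mul, map_smul, smul_mul_assoc, h.aeval_cofactor_mul_F_e, smul_zero, add_zero]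
  · refine h.ext_e fun i => ?_
    rw [mul_assoc, hze, mul_assoc, ← mul_assoc, ← (commute_aeval (h.commute_casimir_e j) _).eq,
      mul_assoc, h.e_mul]
    split_ifs with hij
    · rw [hij, hze]
    · simp

theorem centralMap_injective (h : CyclicRel p c E F e)
    (hdet : ∀ (i : ZMod p) (f : ℂ[X]), f.degree < ((p : ℕ) : WithBot ℕ) →
      aeval (casimir c E F e) f * e i = 0 → f = 0) :
    Function.Injective (centralMap c E F e) := by
  rw [injective_iff_map_eq_zero]
  rintro ⟨f, a⟩ hx
  have hG : ∀ i, centralPoly c f a i = 0 := fun i =>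
    hdet i _ (mem_degreeLT.1 (centralPoly_mem c f a i)) (by
      rw [← h.centralMap_mul_e (f, a), hx, zero_mul])
  have hf : f = 0 := Subtype.ext (by rw [← centralPoly_zero c f a, hG]; rfl)
  have ha : a = 0 := by
    ext i
    have := centralPoly_add_one c f a a.2 i
    rw [hG, hG, zero_add, eq_comm, smul_eq_zero,
      or_iff_left (cofactor_monic c i).ne_zero] at this
    exact this
  rw [hf, ha]; rfl

theorem exists_centralMap_eq (h : CyclicRel p c E F e)
    (hgen : Algebra.adjoin ℂ ({E, F} ∪ Set.range e) = ⊤)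
    (hdet : ∀ (i : ZMod p) (f : ℂ[X]), f.degree < ((p - 1 : ℕ) : WithBot ℕ) →
      aeval (casimir c E F e) f * (E * e i) = 0 → f = 0)
    {z : B} (hz : z ∈ Subalgebra.center ℂ B) : ∃ x, centralMap c E F e x = z := by
  rw [Subalgebra.mem_center_iff] at hz
  have hex : ∀ i, ∃ f : ℂ[X], f.degree < ((p : ℕ) : WithBot ℕ) ∧
      z * e i = aeval (casimir c E F e) f * e i := fun i => by
    obtain ⟨f, hf, hfz⟩ := h.exists_aeval_of_mem_adjoin (x := z) (hgen ▸ Algebra.mem_top) i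
    refine ⟨f, hf, ?_⟩
    rw [← hfz, ← mul_assoc, hz, mul_assoc, h.e_self]
  choose f hfdeg hf using hex
  have hdvd : ∀ i, cofactor c i ∣ f (i + 1) - f i := by
    intro i
    have h0 : aeval (casimir c E F e) (f (i + 1) - f i) * (E * e i) = 0 := by
      have h1 : E * (z * e i) = z * (E * e i) := by rw [← mul_assoc, hz, mul_assoc]
      rw [hf, ← mul_assoc, ← (commute_aeval h.commute_casimir_E _).eq, mul_assoc, h.E_e,
        ← mul_assoc z, hf, mul_assoc] at h1
      rw [map_sub, sub_mul, h.E_e, h1, sub_self]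
    rw [← modByMonic_eq_zero_iff_dvd (cofactor_monic c i)]
    refine hdet i _ ?_ ?_
    · have := degree_modByMonic_lt (f (i + 1) - f i) (cofactor_monic c i)
      rwa [degree_eq_natDegree (cofactor_monic c i).ne_zero, natDegree_cofactor] at this
    · rw [modByMonic_eq_sub_mul_div, map_sub, sub_mul, h0, mul_comm, map_mul, mul_assoc,
        h.aeval_cofactor_mul_E_e, mul_zero, sub_zero]
  have hex : ∀ i, ∃ a : ℂ, f (i + 1) - f i = a • cofactor c i := by
    intro i
    obtain ⟨g, hg⟩ := hdvd i
    have hgdeg : g.degree ≤ 0 := by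
      rw [← natDegree_eq_zero_iff_degree_le_zero]
      by_contra hne
      have hg0 : g ≠ 0 := by rintro rfl; simp at hne
      have h1 : (f (i + 1) - f i).degree < ((p : ℕ) : WithBot ℕ) :=
        (degree_sub_le _ _).trans_lt (max_lt (hfdeg _) (hfdeg _))
      rw [hg, degree_eq_natDegree (mul_ne_zero (cofactor_monic c i).ne_zero hg0),
        natDegree_mul (cofactor_monic c i).ne_zero hg0, natDegree_cofactor] at h1
      have h2 : p - 1 + g.natDegree < p := by exact_mod_cast h1
      omega
    refine ⟨g.coeff 0, ?_⟩
    rw [hg, eq_C_of_degree_le_zero hgdeg, coeff_C_zero, smul_eq_C_mul, mul_comm]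
  choose a ha using hex
  have hsum : ∑ i, a i • cofactor c i = 0 := by
    simp_rw [← ha, Finset.sum_sub_distrib]
    rw [sub_eq_zero]
    exact Equiv.sum_comp (Equiv.addRight (1 : ZMod p)) f
  have hG : ∀ n : ℕ, centralPoly c (f 0) a (n : ZMod p) = f n := by
    intro n
    induction n with
    | zero => rw [Nat.cast_zero, centralPoly_zero]
    | succ n ih =>
      rw [Nat.cast_succ, centralPoly_add_one c (f 0) a hsum, ih, ← ha, add_sub_cancel]
  refine ⟨(⟨f 0, mem_degreeLT.2 (hfdeg 0)⟩, ⟨a, hsum⟩), h.ext_e fun i => ?_⟩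
  rw [h.centralMap_mul_e, hf]
  congr 2
  rw [← ZMod.natCast_zmod_val i]
  exact hG _

/-- The center of an algebra presented by a cyclic system of idempotents. -/
theorem finrank_center (h : CyclicRel p c E F e)
    (hgen : Algebra.adjoin ℂ ({E, F} ∪ Set.range e) = ⊤)
    (hdet₀ : ∀ (i : ZMod p) (f : ℂ[X]), f.degree < ((p : ℕ) : WithBot ℕ) →
      aeval (casimir c E F e) f * e i = 0 → f = 0)
    (hdet₁ : ∀ (i : ZMod p) (f : ℂ[X]), f.degree < ((p - 1 : ℕ) : WithBot ℕ) →
      aeval (casimir c E F e) f * (E * e i) = 0 → f = 0) :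
    FiniteDimensional ℂ (Subalgebra.center ℂ B) ∧
      Module.finrank ℂ (Subalgebra.center ℂ B) + (Finset.univ.image c).card = 2 * p := by
  have hrange : LinearMap.range (centralMap c E F e) =
      Subalgebra.toSubmodule (Subalgebra.center ℂ B) := by
    ext z
    exact ⟨fun ⟨x, hx⟩ => hx ▸ h.centralMap_mem_center hgen x,
      fun hz => h.exists_centralMap_eq hgen hdet₁ hz⟩
  let eqv := (LinearEquiv.ofInjective _ (h.centralMap_injective hdet₀)).trans
    (LinearEquiv.ofEq _ _ hrange)
  have : FiniteDimensional ℂ (degreeLT ℂ p) := Module.Finite.equiv (degreeLTEquiv ℂ p).symm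
  refine ⟨Module.Finite.equiv eqv, ?_⟩
  have h1 : Module.finrank ℂ (Subalgebra.center ℂ B) = _ := eqv.finrank_eq.symm
  have h2 := finrank_ker_cofactorMap c
  rw [ZMod.card] at h2
  rw [h1, Module.finrank_prod, (degreeLTEquiv ℂ p).finrank_eq, Module.finrank_fin_fun]
  omega

end CyclicRel

/-- The defining relations of the restricted quantum group of `sl₂` at the parameter `Q`, in which
the central element `k ^ p` is specialised to the scalar `ε`. -/
structure RestrictedRel {B : Type*} [Ring B] [Algebra ℂ B] (p : ℕ) (Q ε : ℂ) (E F k : B) :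
    Prop where
  E_pow : E ^ p = 0
  F_pow : F ^ p = 0
  k_pow : k ^ p = algebraMap ℂ B ε
  k_E : k * E = Q ^ 2 • (E * k)
  k_F : k * F = (Q ^ 2)⁻¹ • (F * k)
  comm : E * F - F * E = (Q - Q⁻¹)⁻¹ • (k - k ^ (2 * p - 1))

/-- An enumeration `κ` of the `p`-th roots of `ε` by `ℤ/p`, compatible with multiplication
by `Q²`. -/
structure IsWeightSystem (p : ℕ) (Q ε : ℂ) (κ : ZMod p → ℂ) : Prop where
  two_le : 2 ≤ p
  primitive : IsPrimitiveRoot (Q ^ 2) p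
  eps_sq : ε ^ 2 = 1
  succ : ∀ i, κ (i + 1) = Q ^ 2 * κ i
  injective : Function.Injective κ
  pow : ∀ i, κ i ^ p = ε

/-- The constants by which the Casimir element differs from `F * E` on weight spaces. -/
def casimirConst {p : ℕ} (Q : ℂ) (κ : ZMod p → ℂ) (i : ZMod p) : ℂ :=
  (Q - Q⁻¹)⁻¹ * (Q - Q⁻¹)⁻¹ * (Q * κ i + (Q * κ i)⁻¹)

/-- The weight idempotents. -/
def weightIdem {B : Type*} [Ring B] [Algebra ℂ B] {p : ℕ} [NeZero p] (κ : ZMod p → ℂ) (k : B)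
    (i : ZMod p) : B :=
  aeval k (Lagrange.basis Finset.univ κ i)

theorem exists_isWeightSystem {p : ℕ} {Q ε : ℂ} (hp : 2 ≤ p) (hQ : IsPrimitiveRoot (Q ^ 2) p)
    (hε : ε ^ 2 = 1) : ∃ κ : ZMod p → ℂ, IsWeightSystem p Q ε κ := by
  have : NeZero p := ⟨by omega⟩
  obtain ⟨κ₀, hκ₀⟩ := IsAlgClosed.exists_pow_nat_eq ε (NeZero.pos p)
  have hκ₀0 : κ₀ ≠ 0 := by
    rintro rfl
    rw [zero_pow (NeZero.ne p)] at hκ₀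
    rw [← hκ₀] at hε; simp at hε
  refine ⟨fun i => κ₀ * (Q ^ 2) ^ i.val, hp, hQ, hε, fun i => ?_, fun i j hij => ?_, fun i => ?_⟩
  · have h1 : (Q ^ 2) ^ (i + 1).val = (Q ^ 2) ^ (i.val + 1) := by
      rw [ZMod.val_add, ← pow_mod_orderOf, ← pow_mod_orderOf (Q ^ 2) (i.val + 1), ← hQ.eq_orderOf,
        Nat.mod_mod, ← Nat.add_mod_mod, Nat.add_mod i.val 1, ZMod.val_one_eq_one_mod]
      simp
    rw [h1]; ring
  · exact ZMod.val_injective p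
      (hQ.pow_inj (ZMod.val_lt _) (ZMod.val_lt _) (mul_left_cancel₀ hκ₀0 hij))
  · rw [mul_pow, hκ₀, ← pow_mul (Q ^ 2), mul_comm i.val p, pow_mul, hQ.pow_eq_one, one_pow, mul_one]

theorem aeval_mul_of_mul_eq_smul {B : Type*} [Ring B] [Algebra ℂ B] {k v : B} {r : ℂ}
    (h : k * v = r • v) (f : ℂ[X]) : aeval k f * v = f.eval r • v := by
  induction f using Polynomial.induction_on' with
  | add f g hf hg => rw [map_add, add_mul, hf, hg, eval_add, add_smul]
  | monomial n a =>
    have hn : k ^ n * v = r ^ n • v := by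
      induction n with
      | zero => simp
      | succ n ih => rw [pow_succ', mul_assoc, ih, mul_smul_comm, h, smul_smul, pow_succ]
    rw [aeval_monomial, mul_assoc, hn, eval_monomial, ← Algebra.smul_def, smul_smul]

theorem aeval_apply_of_apply_eq_smul {V : Type*} [AddCommGroup V] [Module ℂ V]
    {k : Module.End ℂ V} {v : V} {r : ℂ} (h : k v = r • v) (f : ℂ[X]) :
    aeval k f v = f.eval r • v := by
  induction f using Polynomial.induction_on' with
  | add f g hf hg => rw [map_add, LinearMap.add_apply, hf, hg, eval_add, add_smul]
  | monomial n a =>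
    have hn : (k ^ n) v = r ^ n • v := by
      induction n with
      | zero => simp
      | succ n ih =>
        rw [pow_succ, Module.End.mul_apply, h, map_smul, ih, smul_smul, pow_succ']
    rw [aeval_monomial, Module.End.mul_apply, hn, eval_monomial, Module.algebraMap_end_apply,
      smul_smul]

namespace IsWeightSystem

variable {p : ℕ} {Q ε : ℂ} {κ : ZMod p → ℂ}

theorem eps_ne_zero (hκ : IsWeightSystem p Q ε κ) : ε ≠ 0 := by
  rintro rfl
  simpa using hκ.eps_sq

theorem pow_two_mul_sub_one (hκ : IsWeightSystem p Q ε κ) (i : ZMod p) :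
    κ i ^ (2 * p - 1) = (κ i)⁻¹ := by
  apply eq_inv_of_mul_eq_one_left
  rw [← pow_succ, Nat.sub_add_cancel (by have := hκ.two_le; omega), mul_comm, pow_mul, hκ.pow,
    hκ.eps_sq]

variable [NeZero p]

theorem Q_ne_zero (hκ : IsWeightSystem p Q ε κ) : Q ≠ 0 := by
  rintro rfl
  have := hκ.primitive.ne_zero (NeZero.ne p)
  simp at this

theorem ne_zero (hκ : IsWeightSystem p Q ε κ) (i : ZMod p) : κ i ≠ 0 := by
  intro h
  have := hκ.pow i
  rw [h, zero_pow (NeZero.ne p)] at this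
  exact hκ.eps_ne_zero this.symm

theorem Q_sub_inv_ne_zero (hκ : IsWeightSystem p Q ε κ) : Q - Q⁻¹ ≠ 0 := by
  intro h
  have h1 : Q ^ 2 = 1 := by
    rw [sub_eq_zero] at h
    rw [sq]; nth_rewrite 2 [h]; exact mul_inv_cancel₀ hκ.Q_ne_zero
  have := hκ.primitive.dvd_of_pow_eq_one 1 (by rw [pow_one]; exact h1)
  have := Nat.le_of_dvd one_pos this
  have := hκ.two_le
  omega

theorem casimirConst_sub (hκ : IsWeightSystem p Q ε κ) (i : ZMod p) :
    casimirConst Q κ i - casimirConst Q κ (i - 1) =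
    (Q - Q⁻¹)⁻¹ * (κ i - (κ i)⁻¹) := by
  have h1 := hκ.succ (i - 1)
  rw [sub_add_cancel] at h1
  have h0 := hκ.Q_ne_zero
  have h2 := hκ.Q_sub_inv_ne_zero
  have h3 := hκ.ne_zero (i - 1)
  have h4 : Q ^ 2 - 1 ≠ 0 := by
    intro h; apply h2; field_simp; rw [mul_zero]; exact h
  rw [casimirConst, casimirConst, h1]
  field_simp
  ring

theorem aeval_eq_zero (hκ : IsWeightSystem p Q ε κ) {B : Type*} [Ring B] [Algebra ℂ B] {k : B}
    (hk : k ^ p = algebraMap ℂ B ε) {f : ℂ[X]} (hf : ∀ i, f.eval (κ i) = 0) : aeval k f = 0 := by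
  have hdvd : ∀ g : ℂ[X], (∀ i, g.eval (κ i) = 0) → ∏ i, (X - C (κ i)) ∣ g := fun g hg =>
    Finset.prod_dvd_of_coprime
      (fun i _ j _ hij => isCoprime_X_sub_C_of_isUnit_sub
        (sub_ne_zero.2 (hκ.injective.ne hij)).isUnit)
      (fun i _ => dvd_iff_isRoot.2 (hg i))
  have hP : X ^ p - C ε = ∏ i, (X - C (κ i)) := by
    refine (eq_of_monic_of_dvd_of_natDegree_le (monic_prod_of_monic _ _ fun _ _ => monic_X_sub_C _)
      (monic_X_pow_sub_C ε (NeZero.ne p)) (hdvd _ fun i => ?_) ?_)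
    · simp [hκ.pow]
    · rw [natDegree_X_pow_sub_C, natDegree_prod_of_monic _ _ fun _ _ => monic_X_sub_C _]
      simp [ZMod.card]
  obtain ⟨g, rfl⟩ := hdvd f hf
  rw [← hP, map_mul, map_sub, map_pow, aeval_X, aeval_C, hk, sub_self, zero_mul]

theorem eval_basis (hκ : IsWeightSystem p Q ε κ) (i j : ZMod p) :
    (Lagrange.basis Finset.univ κ i).eval (κ j) = if i = j then 1 else 0 := by
  split_ifs with h
  · rw [h]
    exact Lagrange.eval_basis_self hκ.injective.injOn (Finset.mem_univ _)
  · exact Lagrange.eval_basis_of_ne h (Finset.mem_univ _)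

theorem weightIdem_mul (hκ : IsWeightSystem p Q ε κ)
    {B : Type*} [Ring B] [Algebra ℂ B] {k v : B} {j : ZMod p}
    (h : k * v = κ j • v) (i : ZMod p) : weightIdem κ k i * v = if i = j then v else 0 := by
  rw [weightIdem, aeval_mul_of_mul_eq_smul h, hκ.eval_basis]
  split_ifs <;> simp

theorem mul_weightIdem (hκ : IsWeightSystem p Q ε κ) {B : Type*} [Ring B] [Algebra ℂ B] {k : B}
    (hk : k ^ p = algebraMap ℂ B ε) (i : ZMod p) :
    k * weightIdem κ k i = κ i • weightIdem κ k i := by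
  have := hκ.aeval_eq_zero hk (f := (X - C (κ i)) * Lagrange.basis Finset.univ κ i) (fun j => by
    rw [eval_mul, hκ.eval_basis]
    split_ifs with h
    · simp [h]
    · simp)
  rw [map_mul, map_sub, aeval_X, aeval_C, sub_mul, sub_eq_zero, ← Algebra.smul_def] at this
  exact this

theorem sum_weightIdem (hκ : IsWeightSystem p Q ε κ) {B : Type*} [Ring B] [Algebra ℂ B] (k : B) :
    ∑ i, weightIdem κ k i = 1 := by
  simp only [weightIdem]
  rw [← map_sum, Lagrange.sum_basis hκ.injective.injOn Finset.univ_nonempty, map_one]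

theorem mul_weightIdem_eq (hκ : IsWeightSystem p Q ε κ) {B : Type*} [Ring B] [Algebra ℂ B] {k x : B}
    (d : ZMod p)
    (hx : ∀ i, k * (x * weightIdem κ k i) = κ (i + d) • (x * weightIdem κ k i)) (i : ZMod p) :
    x * weightIdem κ k i = weightIdem κ k (i + d) * x := by
  have h1 : weightIdem κ k (i + d) * (x * weightIdem κ k i) = x * weightIdem κ k i := by
    rw [hκ.weightIdem_mul (hx i), if_pos rfl]
  rw [← h1]
  conv_rhs => rw [← mul_one x, ← hκ.sum_weightIdem k, Finset.mul_sum, Finset.mul_sum]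
  rw [Finset.sum_eq_single i]
  · intro j _ hj
    rw [hκ.weightIdem_mul (hx j), if_neg]
    simpa using hj.symm
  · simp

end IsWeightSystem

namespace RestrictedRel

variable {B : Type*} [Ring B] [Algebra ℂ B] {p : ℕ} [NeZero p] {Q ε : ℂ} {κ : ZMod p → ℂ}
  {E F k : B}

theorem cyclicRel (h : RestrictedRel p Q ε E F k) (hκ : IsWeightSystem p Q ε κ) :
    CyclicRel p (casimirConst Q κ) E F (weightIdem κ k) where
  E_pow := h.E_pow
  F_pow := h.F_pow
  e_mul i j := by
    rw [hκ.weightIdem_mul (hκ.mul_weightIdem h.k_pow j)]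
    split_ifs with hij
    · rw [hij]
    · rfl
  sum_e := hκ.sum_weightIdem k
  E_e := hκ.mul_weightIdem_eq 1 fun i => by
    rw [← mul_assoc, h.k_E, smul_mul_assoc, mul_assoc, hκ.mul_weightIdem h.k_pow, mul_smul_comm,
      smul_smul, hκ.succ]
  F_e i := by
    have := hκ.mul_weightIdem_eq (k := k) (x := F) (-1) (fun i => by
      have h1 := hκ.succ (i + -1)
      rw [neg_add_cancel_right] at h1
      rw [← mul_assoc, h.k_F, smul_mul_assoc, mul_assoc, hκ.mul_weightIdem h.k_pow, mul_smul_comm,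
        smul_smul, h1, inv_mul_cancel_left₀ (pow_ne_zero 2 hκ.Q_ne_zero)]) (i + 1)
    rwa [add_neg_cancel_right] at this
  comm_e i := by
    have hi := hκ.mul_weightIdem h.k_pow i
    have hpow := aeval_mul_of_mul_eq_smul hi (X ^ (2 * p - 1))
    rw [map_pow, aeval_X, eval_pow, eval_X, hκ.pow_two_mul_sub_one] at hpow
    rw [hκ.casimirConst_sub, mul_smul, sub_smul, ← hi, ← hpow, ← sub_mul, ← smul_mul_assoc,
      ← h.comm, sub_mul, mul_assoc, mul_assoc]
    abel

theorem adjoin_eq_top (h : RestrictedRel p Q ε E F k) (hκ : IsWeightSystem p Q ε κ)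
    (hgen : Algebra.adjoin ℂ {E, F, k} = ⊤) :
    Algebra.adjoin ℂ ({E, F} ∪ Set.range (weightIdem κ k)) = ⊤ := by
  rw [← top_le_iff, ← hgen]
  refine Algebra.adjoin_le ?_
  rintro x (rfl | rfl | rfl)
  · exact Algebra.subset_adjoin (by simp)
  · exact Algebra.subset_adjoin (by simp)
  · have hx : x * 1 = ∑ i, κ i • weightIdem κ x i := by
      rw [← hκ.sum_weightIdem x, Finset.mul_sum]
      exact Finset.sum_congr rfl fun i _ => hκ.mul_weightIdem h.k_pow i
    have hmem : ∑ i, κ i • weightIdem κ x i ∈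
        Algebra.adjoin ℂ ({E, F} ∪ Set.range (weightIdem κ x)) :=
      sum_mem fun i _ => Subalgebra.smul_mem _ (Algebra.subset_adjoin
        (Set.mem_union_right _ (Set.mem_range_self i))) _
    rwa [← hx, mul_one] at hmem

end RestrictedRel

namespace VermaRep

/-- The basis vector `F ^ a * E ^ b` applied to the generating vector, understood to be zero when
`p ≤ a` or `p ≤ b`. -/
def vec (p a b : ℕ) : Fin p × Fin p →₀ ℂ :=
  if h : a < p ∧ b < p then Finsupp.single (⟨a, h.1⟩, ⟨b, h.2⟩) 1 else 0

/-- The coordinate of a vector along `vec p a b`. -/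
def coord (p a b : ℕ) (v : Fin p × Fin p →₀ ℂ) : ℂ :=
  if h : a < p ∧ b < p then v (⟨a, h.1⟩, ⟨b, h.2⟩) else 0

/-- The linear map with prescribed values on the basis vectors. -/
def ofFun {p : ℕ} (f : ℕ → ℕ → Fin p × Fin p →₀ ℂ) : Module.End ℂ (Fin p × Fin p →₀ ℂ) :=
  Finsupp.linearCombination ℂ fun x => f x.1 x.2

variable {p : ℕ}

theorem vec_eq_zero_left {a b : ℕ} (h : p ≤ a) : vec p a b = 0 := dif_neg (by omega)

theorem vec_eq_zero_right {a b : ℕ} (h : p ≤ b) : vec p a b = 0 := dif_neg (by omega)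

theorem ofFun_vec {f : ℕ → ℕ → Fin p × Fin p →₀ ℂ} (h : ∀ a b, p ≤ a ∨ p ≤ b → f a b = 0)
    (a b : ℕ) : ofFun f (vec p a b) = f a b := by
  rw [vec]
  split_ifs with hab
  · simp [ofFun]
  · rw [map_zero, h a b (by omega)]

theorem hom_ext {f g : Module.End ℂ (Fin p × Fin p →₀ ℂ)}
    (h : ∀ a b, f (vec p a b) = g (vec p a b)) : f = g := by
  refine Finsupp.lhom_ext' fun ⟨⟨a, ha⟩, ⟨b, hb⟩⟩ => LinearMap.ext_ring ?_
  have := h a b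
  rw [vec, dif_pos ⟨ha, hb⟩] at this
  exact this

theorem coord_add (a b : ℕ) (v w : Fin p × Fin p →₀ ℂ) :
    coord p a b (v + w) = coord p a b v + coord p a b w := by
  unfold coord; split_ifs <;> simp

theorem coord_smul (a b : ℕ) (r : ℂ) (v : Fin p × Fin p →₀ ℂ) :
    coord p a b (r • v) = r * coord p a b v := by
  unfold coord; split_ifs <;> simp

theorem coord_zero (a b : ℕ) : coord p a b 0 = 0 := by
  unfold coord; split_ifs <;> simp

theorem coord_sum {ι : Type*} (s : Finset ι) (a b : ℕ) (v : ι → Fin p × Fin p →₀ ℂ) :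
    coord p a b (∑ i ∈ s, v i) = ∑ i ∈ s, coord p a b (v i) := by
  unfold coord; split_ifs <;> simp [Finsupp.finsetSum_apply]

theorem coord_vec_add {a b n : ℕ} (ha : a + n < p) (hb : b + n < p) :
    coord p (a + n) (b + n) (vec p a b) = if n = 0 then 1 else 0 := by
  rw [coord, dif_pos ⟨ha, hb⟩, vec, dif_pos ⟨by omega, by omega⟩, Finsupp.single_apply]
  simp

variable {T : Module.End ℂ (Fin p × Fin p →₀ ℂ)} {r : ℕ → ℂ}

theorem coord_pow_apply_vec (hT : ∀ a b, T (vec p a b) = vec p (a + 1) (b + 1) + r b • vec p a b)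
    {m n a b : ℕ} (hmn : m ≤ n) (ha : a + n < p) (hb : b + n < p) :
    coord p (a + n) (b + n) ((T ^ m) (vec p a b)) = if m = n then 1 else 0 := by
  induction m generalizing n a b with
  | zero =>
    rw [pow_zero, Module.End.one_apply, coord_vec_add ha hb]
    simp [eq_comm]
  | succ m ih =>
    obtain ⟨n, rfl⟩ : ∃ k, n = k + 1 := ⟨n - 1, by omega⟩
    rw [pow_succ, Module.End.mul_apply, hT, map_add, map_smul, coord_add, coord_smul,
      ih (n := n + 1) (by omega) ha hb, if_neg (by omega), mul_zero, add_zero,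
      show a + (n + 1) = a + 1 + n by ring, show b + (n + 1) = b + 1 + n by ring,
      ih (by omega) (by omega) (by omega)]
    simp

theorem eq_zero_of_aeval_apply_vec
    (hT : ∀ a b, T (vec p a b) = vec p (a + 1) (b + 1) + r b • vec p a b)
    {a b d : ℕ} (ha : a + d ≤ p) (hb : b + d ≤ p) {f : ℂ[X]} (hf : f.degree < (d : WithBot ℕ))
    (h : aeval T f (vec p a b) = 0) : f = 0 := by
  by_contra hf0
  have hd : f.natDegree < d := (natDegree_lt_iff_degree_lt hf0).2 hf
  have h1 := congrArg (coord p (a + f.natDegree) (b + f.natDegree)) h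
  rw [coord_zero, aeval_eq_sum_range, LinearMap.sum_apply, coord_sum, Finset.sum_range_succ,
    Finset.sum_eq_zero, LinearMap.smul_apply, coord_smul,
    coord_pow_apply_vec hT le_rfl (by omega) (by omega)] at h1
  · simp [hf0] at h1
  · intro m hm
    have hm := Finset.mem_range.1 hm
    rw [LinearMap.smul_apply, coord_smul, coord_pow_apply_vec hT hm.le (by omega) (by omega),
      if_neg hm.ne, mul_zero]

section

variable (p) (Q : ℂ) (κ : ZMod p → ℂ) (i₀ : ZMod p)

/-- The action of `F`. -/
def opF : Module.End ℂ (Fin p × Fin p →₀ ℂ) := ofFun fun a b => vec p (a + 1) b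

/-- The action of `k`. -/
def opK : Module.End ℂ (Fin p × Fin p →₀ ℂ) := ofFun fun a b => κ (i₀ + b - a) • vec p a b

/-- The action of `E`. -/
def opE : Module.End ℂ (Fin p × Fin p →₀ ℂ) := ofFun fun a b =>
  vec p a (b + 1) +
    (casimirConst Q κ (i₀ + b) - casimirConst Q κ (i₀ + b - a)) • vec p (a - 1) b

end

variable {Q ε : ℂ} {κ : ZMod p → ℂ} {i₀ : ZMod p}

theorem opF_vec (a b : ℕ) : opF p (vec p a b) = vec p (a + 1) b := by
  refine ofFun_vec (fun a b h => ?_) a b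
  rcases h with h | h
  · exact vec_eq_zero_left (by omega)
  · exact vec_eq_zero_right h

theorem opK_vec (a b : ℕ) : opK p κ i₀ (vec p a b) = κ (i₀ + b - a) • vec p a b := by
  refine ofFun_vec (fun a b h => ?_) a b
  rcases h with h | h
  · rw [vec_eq_zero_left h, smul_zero]
  · rw [vec_eq_zero_right h, smul_zero]

theorem opE_vec (a b : ℕ) : opE p Q κ i₀ (vec p a b) = vec p a (b + 1) +
    (casimirConst Q κ (i₀ + b) - casimirConst Q κ (i₀ + b - a)) • vec p (a - 1) b := by
  refine ofFun_vec (fun a b h => ?_) a b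
  rcases h with h | h
  · rw [vec_eq_zero_left h, zero_add]
    rcases h.eq_or_lt with h | h
    · simp [← h]
    · rw [vec_eq_zero_left (by omega), smul_zero]
  · rw [vec_eq_zero_right (a := a) (by omega), vec_eq_zero_right h, smul_zero, zero_add]

theorem opE_vec_zero (b : ℕ) : opE p Q κ i₀ (vec p 0 b) = vec p 0 (b + 1) := by
  rw [opE_vec]; simp

theorem opE_vec_succ (a b : ℕ) : opE p Q κ i₀ (vec p (a + 1) b) = vec p (a + 1) (b + 1) +
    (casimirConst Q κ (i₀ + b) - casimirConst Q κ (i₀ + b - (a + 1))) • vec p a b := by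
  rw [opE_vec]; simp

theorem comm_vec (a b : ℕ) :
    opE p Q κ i₀ (opF p (vec p a b)) - opF p (opE p Q κ i₀ (vec p a b)) =
      (casimirConst Q κ (i₀ + b - a) - casimirConst Q κ (i₀ + b - a - 1)) • vec p a b := by
  rw [opF_vec, opE_vec_succ]
  cases a with
  | zero => rw [opE_vec_zero, opF_vec]; simp
  | succ a =>
    rw [opE_vec_succ, map_add, map_smul, opF_vec, opF_vec, Nat.cast_succ, add_sub_add_left_eq_sub,
        ← sub_smul, sub_sub (i₀ + b) _ (1 : ZMod p)]
    congr 1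
    ring

theorem opK_opE_vec (a b : ℕ) :
    opK p κ i₀ (opE p Q κ i₀ (vec p a b)) = κ (i₀ + b - a + 1) • opE p Q κ i₀ (vec p a b) := by
  cases a with
  | zero => rw [opE_vec_zero, opK_vec]; congr 2; push_cast; ring
  | succ a =>
    rw [opE_vec_succ, map_add, map_smul, opK_vec, opK_vec, smul_add, smul_comm (κ _)]
    congr 3 <;> (congr 1; push_cast; ring)

theorem opF_pow_vec (n a b : ℕ) : (opF p ^ n) (vec p a b) = vec p (a + n) b := by
  induction n with
  | zero => simp
  | succ n ih => rw [pow_succ', Module.End.mul_apply, ih, opF_vec, add_assoc]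

theorem opE_pow_vec_zero (n b : ℕ) : (opE p Q κ i₀ ^ n) (vec p 0 b) = vec p 0 (b + n) := by
  induction n with
  | zero => simp
  | succ n ih => rw [pow_succ', Module.End.mul_apply, ih, opE_vec_zero, add_assoc]

theorem opK_pow_vec (hκ : IsWeightSystem p Q ε κ) (a b : ℕ) :
    (opK p κ i₀ ^ (2 * p - 1)) (vec p a b) = (κ (i₀ + b - a))⁻¹ • vec p a b := by
  have := aeval_apply_of_apply_eq_smul (opK_vec (p := p) (κ := κ) (i₀ := i₀) a b) (X ^ (2 * p - 1))
  rwa [map_pow, aeval_X, eval_pow, eval_X, hκ.pow_two_mul_sub_one] at this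

theorem comm_eq [NeZero p] (hκ : IsWeightSystem p Q ε κ) :
    opE p Q κ i₀ * opF p - opF p * opE p Q κ i₀ =
      (Q - Q⁻¹)⁻¹ • (opK p κ i₀ - opK p κ i₀ ^ (2 * p - 1)) := by
  refine hom_ext fun a b => ?_
  rw [LinearMap.sub_apply, Module.End.mul_apply, Module.End.mul_apply, comm_vec,
    hκ.casimirConst_sub, LinearMap.smul_apply, LinearMap.sub_apply, opK_pow_vec hκ, opK_vec,
    ← sub_smul, smul_smul]

theorem apply_apply_of_apply_eq_smul [NeZero p] {V : Type*} [AddCommGroup V] [Module ℂ V]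
    {E F k : Module.End ℂ V} (hκ : IsWeightSystem p Q ε κ)
    (hcomm : E * F - F * E = (Q - Q⁻¹)⁻¹ • (k - k ^ (2 * p - 1))) {j : ZMod p} {v : V}
    (hv : k v = κ j • v) :
    E (F v) = F (E v) + (casimirConst Q κ j - casimirConst Q κ (j - 1)) • v := by
  have h1 := congrArg (fun T => T v) hcomm
  have h2 := aeval_apply_of_apply_eq_smul hv (X ^ (2 * p - 1))
  rw [map_pow, aeval_X, eval_pow, eval_X, hκ.pow_two_mul_sub_one] at h2
  simp only [LinearMap.sub_apply, Module.End.mul_apply, LinearMap.smul_apply, h2, hv] at h1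
  rw [hκ.casimirConst_sub, mul_smul, sub_smul, ← h1]
  abel

theorem pow_succ_apply_apply [NeZero p] {V : Type*} [AddCommGroup V] [Module ℂ V]
    {E F k : Module.End ℂ V} (hκ : IsWeightSystem p Q ε κ) (hkE : k * E = Q ^ 2 • (E * k))
    (hcomm : E * F - F * E = (Q - Q⁻¹)⁻¹ • (k - k ^ (2 * p - 1))) (n : ℕ) {j : ZMod p} {v : V}
    (hv : k v = κ j • v) : (E ^ (n + 1)) (F v) = F ((E ^ (n + 1)) v) +
      (casimirConst Q κ (j + n) - casimirConst Q κ (j - 1)) • (E ^ n) v := by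
  have hEF := apply_apply_of_apply_eq_smul hκ hcomm hv
  induction n generalizing j v with
  | zero => simpa using hEF
  | succ n ih =>
    have hEv : k (E v) = κ (j + 1) • E v := by
      have h1 := congrArg (fun T => T v) hkE
      simp only [Module.End.mul_apply, LinearMap.smul_apply, hv, map_smul, smul_smul] at h1
      rw [h1, hκ.succ]
    rw [pow_succ, Module.End.mul_apply, hEF, map_add, map_smul,
      ih hEv (apply_apply_of_apply_eq_smul hκ hcomm hEv), ← Module.End.mul_apply (E ^ (n + 1)) E,
      ← pow_succ, ← Module.End.mul_apply (E ^ n) E, ← pow_succ, add_assoc, ← add_smul,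
      add_sub_cancel_right, Nat.cast_succ, add_assoc j 1, add_comm 1 (n : ZMod p),
      sub_add_sub_cancel]

theorem opK_opE_eq (hκ : IsWeightSystem p Q ε κ) :
    opK p κ i₀ * opE p Q κ i₀ = Q ^ 2 • (opE p Q κ i₀ * opK p κ i₀) := by
  refine hom_ext fun a b => ?_
  rw [LinearMap.smul_apply, Module.End.mul_apply, Module.End.mul_apply, opK_opE_vec, opK_vec,
    map_smul, smul_smul, hκ.succ]

theorem opE_pow [NeZero p] (hκ : IsWeightSystem p Q ε κ) : opE p Q κ i₀ ^ p = 0 := by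
  refine hom_ext fun a b => ?_
  induction a with
  | zero => rw [opE_pow_vec_zero, vec_eq_zero_right (by omega), LinearMap.zero_apply]
  | succ a ih =>
    have hp := hκ.two_le
    have h := pow_succ_apply_apply hκ (opK_opE_eq hκ) (comm_eq hκ) (p - 1)
      (opK_vec (κ := κ) (i₀ := i₀) a b)
    rw [Nat.sub_add_cancel (by omega), ih, LinearMap.zero_apply, map_zero, zero_add,
      Nat.cast_sub (by omega), Nat.cast_one, ZMod.natCast_self, zero_sub, ← sub_eq_add_neg,
      sub_self, zero_smul, opF_vec] at h
    rw [h, LinearMap.zero_apply]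

theorem restrictedRel [NeZero p] (hκ : IsWeightSystem p Q ε κ) :
    RestrictedRel p Q ε (opE p Q κ i₀) (opF p) (opK p κ i₀) where
  E_pow := opE_pow hκ
  F_pow := hom_ext fun a b => by
    rw [opF_pow_vec, vec_eq_zero_left (by omega), LinearMap.zero_apply]
  k_pow := hom_ext fun a b => by
    have := aeval_apply_of_apply_eq_smul (opK_vec (p := p) (κ := κ) (i₀ := i₀) a b) (X ^ p)
    rw [map_pow, aeval_X, eval_pow, eval_X, hκ.pow] at this
    rw [this, Module.algebraMap_end_apply]
  k_E := opK_opE_eq hκ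
  k_F := hom_ext fun a b => by
    have h := hκ.succ (i₀ + b - (a + 1))
    rw [← sub_sub, sub_add_cancel] at h
    rw [LinearMap.smul_apply, Module.End.mul_apply, Module.End.mul_apply, opF_vec, opK_vec,
      opK_vec, map_smul, opF_vec, smul_smul, h, Nat.cast_succ, ← sub_sub,
      inv_mul_cancel_left₀ (pow_ne_zero 2 hκ.Q_ne_zero)]
  comm := comm_eq hκ

theorem casimir_vec [NeZero p] (hκ : IsWeightSystem p Q ε κ) (a b : ℕ) :
    casimir (casimirConst Q κ) (opE p Q κ i₀) (opF p) (weightIdem κ (opK p κ i₀)) (vec p a b) =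
      vec p (a + 1) (b + 1) + casimirConst Q κ (i₀ + b) • vec p a b := by
  have hsum : (∑ i, casimirConst Q κ i • weightIdem κ (opK p κ i₀) i) (vec p a b) =
      casimirConst Q κ (i₀ + b - a) • vec p a b := by
    simp only [LinearMap.sum_apply, LinearMap.smul_apply, weightIdem,
      aeval_apply_of_apply_eq_smul (opK_vec a b), hκ.eval_basis, ite_smul, one_smul, zero_smul,
      smul_ite, smul_zero, Finset.sum_ite_eq', Finset.mem_univ, if_true]
  rw [casimir, LinearMap.add_apply, hsum, Module.End.mul_apply]
  cases a with
  | zero => rw [opE_vec_zero, opF_vec]; simp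
  | succ a =>
    rw [opE_vec_succ, map_add, map_smul, opF_vec, opF_vec, add_assoc, ← add_smul, Nat.cast_succ,
      sub_add_cancel]

end VermaRep

/-- There is a representation with a vector of any given weight on which the powers of the
Casimir element act independently. -/
theorem IsWeightSystem.exists_rep {p : ℕ} [NeZero p] {Q ε : ℂ} {κ : ZMod p → ℂ}
    (hκ : IsWeightSystem p Q ε κ) (i₀ : ZMod p) :
    ∃ (E F k : Module.End ℂ (Fin p × Fin p →₀ ℂ)) (v : Fin p × Fin p →₀ ℂ),
      RestrictedRel p Q ε E F k ∧ k v = κ i₀ • v ∧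
      (∀ f : ℂ[X], f.degree < ((p : ℕ) : WithBot ℕ) →
        aeval (casimir (casimirConst Q κ) E F (weightIdem κ k)) f v = 0 → f = 0) ∧
      ∀ f : ℂ[X], f.degree < ((p - 1 : ℕ) : WithBot ℕ) →
        aeval (casimir (casimirConst Q κ) E F (weightIdem κ k)) f (E v) = 0 → f = 0 := by
  have hp := hκ.two_le
  refine ⟨VermaRep.opE p Q κ i₀, VermaRep.opF p, VermaRep.opK p κ i₀, VermaRep.vec p 0 0,
    VermaRep.restrictedRel hκ, ?_, fun f hf h => ?_, fun f hf h => ?_⟩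
  · rw [VermaRep.opK_vec]; simp
  · exact VermaRep.eq_zero_of_aeval_apply_vec (r := fun b => casimirConst Q κ (i₀ + b))
      (VermaRep.casimir_vec hκ) (zero_add p).le (zero_add p).le hf h
  · rw [VermaRep.opE_vec_zero] at h
    exact VermaRep.eq_zero_of_aeval_apply_vec (r := fun b => casimirConst Q κ (i₀ + b))
      (VermaRep.casimir_vec hκ) (by omega) (by omega) hf h

/-- The generators of the restricted quantum group of `sl₂`. -/
inductive RestrictedGen : Type
  | E | F | k

/-- The relations of the restricted quantum group of `sl₂` with specialised central element. -/
inductive RestrictedFreeRel (p : ℕ) (Q ε : ℂ) :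
    FreeAlgebra ℂ RestrictedGen → FreeAlgebra ℂ RestrictedGen → Prop
  | E_pow : RestrictedFreeRel p Q ε (FreeAlgebra.ι ℂ .E ^ p) 0
  | F_pow : RestrictedFreeRel p Q ε (FreeAlgebra.ι ℂ .F ^ p) 0
  | k_pow : RestrictedFreeRel p Q ε (FreeAlgebra.ι ℂ .k ^ p) (algebraMap ℂ _ ε)
  | k_E : RestrictedFreeRel p Q ε (FreeAlgebra.ι ℂ .k * FreeAlgebra.ι ℂ .E)
      (Q ^ 2 • (FreeAlgebra.ι ℂ .E * FreeAlgebra.ι ℂ .k))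
  | k_F : RestrictedFreeRel p Q ε (FreeAlgebra.ι ℂ .k * FreeAlgebra.ι ℂ .F)
      ((Q ^ 2)⁻¹ • (FreeAlgebra.ι ℂ .F * FreeAlgebra.ι ℂ .k))
  | comm : RestrictedFreeRel p Q ε (FreeAlgebra.ι ℂ .E * FreeAlgebra.ι ℂ .F -
        FreeAlgebra.ι ℂ .F * FreeAlgebra.ι ℂ .E)
      ((Q - Q⁻¹)⁻¹ • (FreeAlgebra.ι ℂ .k - FreeAlgebra.ι ℂ .k ^ (2 * p - 1)))

/-- The restricted quantum group of `sl₂`, with the central element `k ^ p` specialised to `ε`. -/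
abbrev RestrictedAlg (p : ℕ) (Q ε : ℂ) : Type := RingQuot (RestrictedFreeRel p Q ε)

namespace RestrictedAlg

variable {p : ℕ} {Q ε : ℂ}

/-- The images of the generators. -/
def gen (p : ℕ) (Q ε : ℂ) (x : RestrictedGen) : RestrictedAlg p Q ε :=
  RingQuot.mkAlgHom ℂ (RestrictedFreeRel p Q ε) (FreeAlgebra.ι ℂ x)

theorem restrictedRel : RestrictedRel p Q ε (gen p Q ε .E) (gen p Q ε .F) (gen p Q ε .k) where
  E_pow := by simpa [gen] using
    RingQuot.mkAlgHom_rel ℂ (RestrictedFreeRel.E_pow (p := p) (Q := Q) (ε := ε))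
  F_pow := by simpa [gen] using
    RingQuot.mkAlgHom_rel ℂ (RestrictedFreeRel.F_pow (p := p) (Q := Q) (ε := ε))
  k_pow := by simpa [gen] using
    RingQuot.mkAlgHom_rel ℂ (RestrictedFreeRel.k_pow (p := p) (Q := Q) (ε := ε))
  k_E := by simpa [gen] using
    RingQuot.mkAlgHom_rel ℂ (RestrictedFreeRel.k_E (p := p) (Q := Q) (ε := ε))
  k_F := by simpa [gen] using
    RingQuot.mkAlgHom_rel ℂ (RestrictedFreeRel.k_F (p := p) (Q := Q) (ε := ε))
  comm := by simpa [gen] using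
    RingQuot.mkAlgHom_rel ℂ (RestrictedFreeRel.comm (p := p) (Q := Q) (ε := ε))

theorem adjoin_range_gen : Algebra.adjoin ℂ (Set.range (gen p Q ε)) = ⊤ := by
  rw [show gen p Q ε = RingQuot.mkAlgHom ℂ (RestrictedFreeRel p Q ε) ∘ FreeAlgebra.ι ℂ from rfl,
    Set.range_comp, ← AlgHom.map_adjoin, FreeAlgebra.adjoin_range_ι, Algebra.map_top,
    AlgHom.range_eq_top]
  exact RingQuot.mkAlgHom_surjective ℂ _

theorem adjoin_gen : Algebra.adjoin ℂ {gen p Q ε .E, gen p Q ε .F, gen p Q ε .k} = ⊤ := by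
  rw [← adjoin_range_gen]
  congr 1
  ext x
  constructor
  · rintro (rfl | rfl | rfl) <;> exact ⟨_, rfl⟩
  · rintro ⟨_ | _ | _, rfl⟩ <;> simp

variable {B : Type*} [Ring B] [Algebra ℂ B]

/-- The images of the generators under the homomorphism attached to a solution of the
relations. -/
def values (E F k : B) : RestrictedGen → B
  | .E => E
  | .F => F
  | .k => k

/-- The universal property. -/
def lift {E F k : B} (h : RestrictedRel p Q ε E F k) : RestrictedAlg p Q ε →ₐ[ℂ] B :=
  RingQuot.liftAlgHom ℂ ⟨FreeAlgebra.lift ℂ (values E F k), by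
    rintro _ _ (_ | _ | _ | _ | _ | _)
    · simpa [values] using h.E_pow
    · simpa [values] using h.F_pow
    · simpa [values] using h.k_pow
    · simpa [values] using h.k_E
    · simpa [values] using h.k_F
    · simpa [values] using h.comm⟩

theorem lift_gen {E F k : B} (h : RestrictedRel p Q ε E F k) (x : RestrictedGen) :
    lift h (gen p Q ε x) = values E F k x := by
  simp [lift, gen]

theorem finrank_center_add [NeZero p] {κ : ZMod p → ℂ} (hκ : IsWeightSystem p Q ε κ) :
    FiniteDimensional ℂ (Subalgebra.center ℂ (RestrictedAlg p Q ε)) ∧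
      Module.finrank ℂ (Subalgebra.center ℂ (RestrictedAlg p Q ε)) +
        (Finset.univ.image (casimirConst Q κ)).card = 2 * p := by
  have hmap (E F k : Module.End ℂ (Fin p × Fin p →₀ ℂ)) (h : RestrictedRel p Q ε E F k)
      (f : ℂ[X]) :
      lift h (aeval (casimir (casimirConst Q κ) (gen p Q ε .E) (gen p Q ε .F)
        (weightIdem κ (gen p Q ε .k))) f) =
      aeval (casimir (casimirConst Q κ) E F (weightIdem κ k)) f := by
    rw [← aeval_algHom_apply]
    congr 1
    simp [casimir, weightIdem, ← aeval_algHom_apply, lift_gen, values]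
  have hidem (E F k : Module.End ℂ (Fin p × Fin p →₀ ℂ)) (h : RestrictedRel p Q ε E F k) (i)
      {v : Fin p × Fin p →₀ ℂ} (hv : k v = κ i • v) :
      lift h (weightIdem κ (gen p Q ε .k) i) v = v := by
    rw [weightIdem, ← aeval_algHom_apply, lift_gen]
    rw [show values E F k .k = k from rfl, aeval_apply_of_apply_eq_smul hv, hκ.eval_basis,
      if_pos rfl, one_smul]
  refine (restrictedRel.cyclicRel hκ).finrank_center
    (restrictedRel.adjoin_eq_top hκ adjoin_gen) (fun i f hf h => ?_) (fun i f hf h => ?_)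
  · obtain ⟨E, F, k, v, hr, hv, h0, -⟩ := hκ.exists_rep i
    have := congrArg (fun x => lift hr x v) h
    simp only [map_mul, Module.End.mul_apply, hidem E F k hr i hv, hmap, map_zero,
      LinearMap.zero_apply] at this
    exact h0 f hf this
  · obtain ⟨E, F, k, v, hr, hv, -, h1⟩ := hκ.exists_rep i
    have := congrArg (fun x => lift hr x v) h
    simp only [map_mul, Module.End.mul_apply, hidem E F k hr i hv, hmap, map_zero,
      LinearMap.zero_apply, lift_gen, values] at this
    exact h1 f hf this

end RestrictedAlg

theorem IsWeightSystem.two_mul_card_image_casimirConst {p : ℕ} [NeZero p] {Q ε : ℂ}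
    {κ : ZMod p → ℂ} (hκ : IsWeightSystem p Q ε κ) :
    2 * (Finset.univ.image (casimirConst Q κ)).card =
      p + (({1, -1} : Finset ℂ).filter fun x => x ^ p = Q ^ p * ε).card := by
  have hQ := hκ.Q_ne_zero
  have hδ : (Q ^ p * ε) ^ 2 = 1 := by
    rw [mul_pow, hκ.eps_sq, mul_one, ← pow_mul, mul_comm, pow_mul, hκ.primitive.pow_eq_one]
  have hδ0 : Q ^ p * ε ≠ 0 := mul_ne_zero (pow_ne_zero _ hQ) hκ.eps_ne_zero
  have hp := NeZero.pos p
  have hcard : (Finset.univ.image fun i => Q * κ i).card = p := by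
    rw [Finset.card_image_of_injective _ fun i j h => hκ.injective (mul_left_cancel₀ hQ h),
      Finset.card_univ, ZMod.card]
  have hs : (Finset.univ.image fun i => Q * κ i) = (nthRoots p (Q ^ p * ε)).toFinset := by
    refine Finset.eq_of_subset_of_card_le (fun x hx => ?_) ?_
    · obtain ⟨i, -, rfl⟩ := Finset.mem_image.1 hx
      rw [Multiset.mem_toFinset, mem_nthRoots hp, mul_pow, hκ.pow]
    · rw [hcard]
      exact (Multiset.toFinset_card_le _).trans (card_nthRoots _ _)
  have hmem (x : ℂ) : x ∈ Finset.univ.image (fun i => Q * κ i) ↔ x ^ p = Q ^ p * ε := by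
    rw [hs, Multiset.mem_toFinset, mem_nthRoots hp]
  have himage : (Finset.univ.image (casimirConst Q κ)) =
      (((Finset.univ.image fun i => Q * κ i).image fun x => x + x⁻¹).image
        fun y => (Q - Q⁻¹)⁻¹ * (Q - Q⁻¹)⁻¹ * y) := by
    rw [Finset.image_image, Finset.image_image]; rfl
  have hQ' := inv_ne_zero hκ.Q_sub_inv_ne_zero
  rw [himage, Finset.card_image_of_injective _ (mul_right_injective₀ (mul_ne_zero hQ' hQ')),
    two_mul_card_image_add_inv _ (fun x hx h0 => ?_) (fun x hx => ?_), hcard]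
  · congr 2
    ext x
    rw [Finset.mem_filter, Finset.mem_filter, hmem, sq_eq_one_iff]
    simp [and_comm]
  · rw [hmem, h0, zero_pow hp.ne'] at hx
    exact hδ0 hx.symm
  · rw [hmem] at hx ⊢
    rw [inv_pow, hx]
    exact inv_eq_of_mul_eq_one_left (by rw [← sq, hδ])

namespace RestrictedAlg

variable {p : ℕ} {Q ε : ℂ}

theorem finiteDimensional_center (hp : 2 ≤ p) (hQ : IsPrimitiveRoot (Q ^ 2) p) (hε : ε ^ 2 = 1) :
    FiniteDimensional ℂ (Subalgebra.center ℂ (RestrictedAlg p Q ε)) := by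
  have : NeZero p := ⟨by omega⟩
  obtain ⟨κ, hκ⟩ := exists_isWeightSystem hp hQ hε
  exact (finrank_center_add hκ).1

theorem two_mul_finrank_center_add (hp : 2 ≤ p) (hQ : IsPrimitiveRoot (Q ^ 2) p)
    (hε : ε ^ 2 = 1) :
    2 * Module.finrank ℂ (Subalgebra.center ℂ (RestrictedAlg p Q ε)) +
      (({1, -1} : Finset ℂ).filter fun x => x ^ p = Q ^ p * ε).card = 3 * p := by
  have : NeZero p := ⟨by omega⟩
  obtain ⟨κ, hκ⟩ := exists_isWeightSystem hp hQ hε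
  have h1 := (finrank_center_add hκ).2
  have h2 := hκ.two_mul_card_image_casimirConst
  omega

theorem pow_eq_one_or_eq_neg_one (hQ : IsPrimitiveRoot (Q ^ 2) p) : Q ^ p = 1 ∨ Q ^ p = -1 := by
  rw [← sq_eq_one_iff, ← pow_mul, mul_comm, pow_mul, hQ.pow_eq_one]

theorem finrank_center_of_odd (hp : 2 ≤ p) (hodd : Odd p) (hQ : IsPrimitiveRoot (Q ^ 2) p)
    (hε : ε = 1 ∨ ε = -1) :
    2 * Module.finrank ℂ (Subalgebra.center ℂ (RestrictedAlg p Q ε)) + 1 = 3 * p := by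
  have hε' : ε ^ 2 = 1 := by rcases hε with rfl | rfl <;> norm_num
  rw [← two_mul_finrank_center_add hp hQ hε']
  have h1 : (1 : ℂ) ≠ -1 := by norm_num
  congr 1
  rcases pow_eq_one_or_eq_neg_one hQ with h | h <;> rcases hε with rfl | rfl <;>
    simp [Finset.filter_insert, Finset.filter_singleton, h, hodd.neg_one_pow, h1, h1.symm]

theorem finrank_center_add_finrank_center (hp : 2 ≤ p) (hQ : IsPrimitiveRoot (Q ^ 2) p) :
    Module.finrank ℂ (Subalgebra.center ℂ (RestrictedAlg p Q 1)) +
      Module.finrank ℂ (Subalgebra.center ℂ (RestrictedAlg p Q (-1))) + 1 = 3 * p := by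
  have h1 : (1 : ℂ) ≠ -1 := by norm_num
  rcases p.even_or_odd with he | ho
  · have ha := two_mul_finrank_center_add (ε := 1) hp hQ (by norm_num)
    have hb := two_mul_finrank_center_add (ε := -1) hp hQ (by norm_num)
    rcases pow_eq_one_or_eq_neg_one hQ with h | h <;>
      simp [Finset.filter_insert, Finset.filter_singleton, h, he.neg_one_pow, h1]
        at ha hb <;> omega
  · have ha := finrank_center_of_odd hp ho hQ (Or.inl rfl)
    have hb := finrank_center_of_odd hp ho hQ (Or.inr rfl)
    omega

end RestrictedAlg

/-- The relations of the quantum group `g_{p,p'}` that involve one pair of generators. -/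
structure QGHalfRel {A : Type*} [Ring A] [Algebra ℂ A] (p m : ℕ) (E F k : A) : Prop where
  E_pow : E ^ p = 0
  F_pow : F ^ p = 0
  k_E : k * E = rootOfUnity p ^ 2 • (E * k)
  k_F : k * F = (rootOfUnity p ^ 2)⁻¹ • (F * k)
  comm : E * F - F * E = (rootOfUnity p ^ m - (rootOfUnity p ^ m)⁻¹)⁻¹ •
    (k ^ m - k ^ (2 * p * m - m))

/-- The relations stating that two pairs of generators commute with each other. -/
structure PairsCommute {A : Type*} [Ring A] (E₁ F₁ E₂ F₂ : A) : Prop where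
  E_E : Commute E₁ E₂
  E_F : Commute E₁ F₂
  F_E : Commute F₁ E₂
  F_F : Commute F₁ F₂

theorem isPrimitiveRoot_rootOfUnity_sq {p : ℕ} (hp : p ≠ 0) :
    IsPrimitiveRoot (rootOfUnity p ^ 2) p := by
  convert Complex.isPrimitiveRoot_exp p hp using 1
  rw [rootOfUnity, ← Complex.exp_nat_mul]
  congr 1
  push_cast
  ring

theorem isPrimitiveRoot_rootOfUnity_pow_sq {p p' : ℕ} (hp : p ≠ 0) (h : Nat.Coprime p p') :
    IsPrimitiveRoot ((rootOfUnity p ^ p') ^ 2) p := by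
  rw [← pow_mul, mul_comm, pow_mul]
  exact (isPrimitiveRoot_rootOfUnity_sq hp).pow_of_coprime p' h.symm

theorem pow_mul_eq_smul {A : Type*} [Ring A] [Algebra ℂ A] {k x : A} {r : ℂ}
    (h : k * x = r • (x * k)) (n : ℕ) : k ^ n * x = r ^ n • (x * k ^ n) := by
  induction n with
  | zero => simp
  | succ n ih =>
    rw [pow_succ', mul_assoc, ih, mul_smul_comm, ← mul_assoc, h, smul_mul_assoc, smul_smul,
      mul_assoc, ← pow_succ]

namespace QGHalfRel

variable {A : Type*} [Ring A] [Algebra ℂ A] {p p' : ℕ} {ε : ℂ} {E F k : A}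

theorem map {B : Type*} [Ring B] [Algebra ℂ B] (h : QGHalfRel p p' E F k) (f : A →ₐ[ℂ] B) :
    QGHalfRel p p' (f E) (f F) (f k) where
  E_pow := by rw [← map_pow, h.E_pow, map_zero]
  F_pow := by rw [← map_pow, h.F_pow, map_zero]
  k_E := by rw [← map_mul, h.k_E, map_smul, map_mul]
  k_F := by rw [← map_mul, h.k_F, map_smul, map_mul]
  comm := by rw [← map_mul, ← map_mul, ← map_sub, h.comm, map_smul, map_sub, map_pow, map_pow]

theorem commute_E (h : QGHalfRel p p' E F k) (hp : p ≠ 0) : Commute (k ^ p) E := by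
  have := pow_mul_eq_smul h.k_E p
  rwa [(isPrimitiveRoot_rootOfUnity_sq hp).pow_eq_one, one_smul] at this

theorem commute_F (h : QGHalfRel p p' E F k) (hp : p ≠ 0) : Commute (k ^ p) F := by
  have := pow_mul_eq_smul h.k_F p
  rwa [inv_pow, (isPrimitiveRoot_rootOfUnity_sq hp).pow_eq_one, inv_one, one_smul] at this

theorem restrictedRel (h : QGHalfRel p p' E F k) (hk : k ^ (p * p') = algebraMap ℂ A ε) :
    RestrictedRel p (rootOfUnity p ^ p') ε E F (k ^ p') where
  E_pow := h.E_pow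
  F_pow := h.F_pow
  k_pow := by rw [← pow_mul, mul_comm, hk]
  k_E := by rw [pow_mul_eq_smul h.k_E, pow_right_comm]
  k_F := by rw [pow_mul_eq_smul h.k_F, pow_right_comm, inv_pow]
  comm := by rw [h.comm, ← pow_mul k, Nat.mul_sub, mul_one, mul_comm p' (2 * p)]

end QGHalfRel

theorem RestrictedRel.qgHalfRel {A : Type*} [Ring A] [Algebra ℂ A] {p p' a : ℕ} {ε : ℂ}
    {E F k y : A} (h : RestrictedRel p (rootOfUnity p ^ p') ε E F k) (hp : p ≠ 0)
    (ha : a * p' ≡ 1 [MOD p]) (hE : Commute y E) (hF : Commute y F)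
    (hpow : (k ^ a * y) ^ p' = k) : QGHalfRel p p' E F (k ^ a * y) := by
  have hr := isPrimitiveRoot_rootOfUnity_sq hp
  have hq : ((rootOfUnity p ^ p') ^ 2) ^ a = rootOfUnity p ^ 2 := by
    rw [pow_right_comm (rootOfUnity p), ← pow_mul (rootOfUnity p ^ 2), mul_comm]
    rw [pow_eq_pow_mod _ hr.pow_eq_one, ha, ← pow_eq_pow_mod _ hr.pow_eq_one, pow_one]
  refine ⟨h.E_pow, h.F_pow, ?_, ?_, ?_⟩
  · rw [mul_assoc, hE.eq, ← mul_assoc, pow_mul_eq_smul h.k_E, hq, smul_mul_assoc, mul_assoc]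
  · rw [mul_assoc, hF.eq, ← mul_assoc, pow_mul_eq_smul h.k_F, inv_pow, hq, smul_mul_assoc,
      mul_assoc]
  · rw [h.comm, show 2 * p * p' - p' = p' * (2 * p - 1) by rw [Nat.mul_sub, mul_one, mul_comm],
      pow_mul _ p', hpow]

namespace QG

variable {pp pm : ℕ}

/-- The images of the generators. -/
def gen (pp pm : ℕ) (x : QGGen) : QG pp pm :=
  RingQuot.mkAlgHom ℂ (QGRel pp pm) (FreeAlgebra.ι ℂ x)

theorem halfRel_plus : QGHalfRel pp pm (gen pp pm .Ep) (gen pp pm .Fp) (gen pp pm .K) where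
  E_pow := by simpa [gen] using RingQuot.mkAlgHom_rel ℂ (QGRel.EpNil (pp := pp) (pm := pm))
  F_pow := by simpa [gen] using RingQuot.mkAlgHom_rel ℂ (QGRel.FpNil (pp := pp) (pm := pm))
  k_E := by
    simpa [gen, Algebra.smul_def] using RingQuot.mkAlgHom_rel ℂ (QGRel.KEp (pp := pp) (pm := pm))
  k_F := by
    simpa [gen, Algebra.smul_def] using RingQuot.mkAlgHom_rel ℂ (QGRel.KFp (pp := pp) (pm := pm))
  comm := by
    simpa [gen, Algebra.smul_def] using RingQuot.mkAlgHom_rel ℂ (QGRel.EpFp (pp := pp) (pm := pm))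

theorem halfRel_minus : QGHalfRel pm pp (gen pp pm .Em) (gen pp pm .Fm) (gen pp pm .K) where
  E_pow := by simpa [gen] using RingQuot.mkAlgHom_rel ℂ (QGRel.EmNil (pp := pp) (pm := pm))
  F_pow := by simpa [gen] using RingQuot.mkAlgHom_rel ℂ (QGRel.FmNil (pp := pp) (pm := pm))
  k_E := by
    simpa [gen, Algebra.smul_def] using RingQuot.mkAlgHom_rel ℂ (QGRel.KEm (pp := pp) (pm := pm))
  k_F := by
    simpa [gen, Algebra.smul_def] using RingQuot.mkAlgHom_rel ℂ (QGRel.KFm (pp := pp) (pm := pm))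
  comm := by
    rw [mul_right_comm]
    simpa [gen, Algebra.smul_def] using RingQuot.mkAlgHom_rel ℂ (QGRel.EmFm (pp := pp) (pm := pm))

theorem pairsCommute :
    PairsCommute (gen pp pm .Ep) (gen pp pm .Fp) (gen pp pm .Em) (gen pp pm .Fm) where
  E_E := by
    simpa [gen, commute_iff_eq] using RingQuot.mkAlgHom_rel ℂ (QGRel.EpEm (pp := pp) (pm := pm))
  E_F := by
    simpa [gen, commute_iff_eq] using RingQuot.mkAlgHom_rel ℂ (QGRel.EpFm (pp := pp) (pm := pm))
  F_E := by
    simpa [gen, commute_iff_eq] using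
      (RingQuot.mkAlgHom_rel ℂ (QGRel.EmFp (pp := pp) (pm := pm))).symm
  F_F := by
    simpa [gen, commute_iff_eq] using RingQuot.mkAlgHom_rel ℂ (QGRel.FpFm (pp := pp) (pm := pm))

theorem gen_K_pow : gen pp pm .K ^ (2 * pp * pm) = 1 := by
  simpa [gen] using RingQuot.mkAlgHom_rel ℂ (QGRel.KOrd (pp := pp) (pm := pm))

variable {A : Type*} [Ring A] [Algebra ℂ A]

/-- The images of the generators under the homomorphism attached to a solution of the
relations. -/
def values (E₁ F₁ E₂ F₂ k : A) : QGGen → A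
  | .Ep => E₁
  | .Fp => F₁
  | .Em => E₂
  | .Fm => F₂
  | .K => k

/-- The universal property. -/
def lift {E₁ F₁ E₂ F₂ k : A} (h₁ : QGHalfRel pp pm E₁ F₁ k) (h₂ : QGHalfRel pm pp E₂ F₂ k)
    (h : PairsCommute E₁ F₁ E₂ F₂) (hk : k ^ (2 * pp * pm) = 1) : QG pp pm →ₐ[ℂ] A :=
  RingQuot.liftAlgHom ℂ ⟨FreeAlgebra.lift ℂ (values E₁ F₁ E₂ F₂ k), by
    rintro _ _ (_ | _ | _ | _ | _ | _ | _ | _ | _ | _ | _ | _ | _ | _ | _)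
    · simpa [values] using h₁.E_pow
    · simpa [values] using h₁.F_pow
    · simpa [values] using h₂.E_pow
    · simpa [values] using h₂.F_pow
    · simpa [values] using hk
    · simpa [values, Algebra.smul_def] using h₁.k_E
    · simpa [values, Algebra.smul_def] using h₁.k_F
    · simpa [values, Algebra.smul_def] using h₂.k_E
    · simpa [values, Algebra.smul_def] using h₂.k_F
    · simpa [values] using h.E_E.eq
    · simpa [values] using h.F_F.eq
    · simpa [values] using h.E_F.eq
    · simpa [values] using h.F_E.eq.symm
    · simpa [values, Algebra.smul_def] using h₁.comm
    · have := h₂.comm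
      rw [mul_right_comm] at this
      simpa [values, Algebra.smul_def] using this⟩

theorem lift_gen {E₁ F₁ E₂ F₂ k : A} (h₁ : QGHalfRel pp pm E₁ F₁ k)
    (h₂ : QGHalfRel pm pp E₂ F₂ k) (h : PairsCommute E₁ F₁ E₂ F₂)
    (hk : k ^ (2 * pp * pm) = 1) (x : QGGen) :
    lift h₁ h₂ h hk (gen pp pm x) = values E₁ F₁ E₂ F₂ k x := by
  simp [lift, gen]

theorem adjoin_range_gen : Algebra.adjoin ℂ (Set.range (gen pp pm)) = ⊤ := by
  rw [show gen pp pm = RingQuot.mkAlgHom ℂ (QGRel pp pm) ∘ FreeAlgebra.ι ℂ from rfl,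
    Set.range_comp, ← AlgHom.map_adjoin, FreeAlgebra.adjoin_range_ι, Algebra.map_top,
    AlgHom.range_eq_top]
  exact RingQuot.mkAlgHom_surjective ℂ _

theorem algHom_ext {f g : QG pp pm →ₐ[ℂ] A} (h : ∀ x, f (gen pp pm x) = g (gen pp pm x)) :
    f = g :=
  RingQuot.ringQuot_ext' _ _ _ (FreeAlgebra.hom_ext (funext h))

end QG

theorem RestrictedRel.map {A B : Type*} [Ring A] [Algebra ℂ A] [Ring B] [Algebra ℂ B] {p : ℕ}
    {Q ε : ℂ} {E F k : A} (h : RestrictedRel p Q ε E F k) (f : A →ₐ[ℂ] B) :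
    RestrictedRel p Q ε (f E) (f F) (f k) where
  E_pow := by rw [← map_pow, h.E_pow, map_zero]
  F_pow := by rw [← map_pow, h.F_pow, map_zero]
  k_pow := by rw [← map_pow, h.k_pow, AlgHom.commutes]
  k_E := by rw [← map_mul, h.k_E, map_smul, map_mul]
  k_F := by rw [← map_mul, h.k_F, map_smul, map_mul]
  comm := by rw [← map_mul, ← map_mul, ← map_sub, h.comm, map_smul, map_sub, map_pow]

theorem RestrictedRel.tmul_one {A : Type*} (B : Type*) [Ring A] [Algebra ℂ A] [Ring B]
    [Algebra ℂ B] {p : ℕ} {Q ε : ℂ} {E F k : A} (h : RestrictedRel p Q ε E F k) :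
    RestrictedRel p Q ε (E ⊗ₜ[ℂ] (1 : B)) (F ⊗ₜ[ℂ] (1 : B)) (k ⊗ₜ[ℂ] (1 : B)) :=
  h.map (Algebra.TensorProduct.includeLeft : A →ₐ[ℂ] A ⊗[ℂ] B)

theorem RestrictedRel.one_tmul (A : Type*) {B : Type*} [Ring A] [Algebra ℂ A] [Ring B]
    [Algebra ℂ B] {p : ℕ} {Q ε : ℂ} {E F k : B} (h : RestrictedRel p Q ε E F k) :
    RestrictedRel p Q ε ((1 : A) ⊗ₜ[ℂ] E) ((1 : A) ⊗ₜ[ℂ] F) ((1 : A) ⊗ₜ[ℂ] k) :=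
  h.map (Algebra.TensorProduct.includeRight : B →ₐ[ℂ] A ⊗[ℂ] B)

theorem commute_tmul_one_one_tmul {A B : Type*} [Ring A] [Algebra ℂ A] [Ring B] [Algebra ℂ B]
    (x : A) (y : B) : Commute (x ⊗ₜ[ℂ] (1 : B)) ((1 : A) ⊗ₜ[ℂ] y) := by
  simp [commute_iff_eq]

theorem RestrictedAlg.commute_of_commute_gen {p p' : ℕ} {Q Q' ε ε' : ℂ} {A : Type*} [Ring A]
    [Algebra ℂ A] (f : RestrictedAlg p Q ε →ₐ[ℂ] A) (g : RestrictedAlg p' Q' ε' →ₐ[ℂ] A)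
    (h : ∀ x y, Commute (f (gen p Q ε x)) (g (gen p' Q' ε' y))) (x : RestrictedAlg p Q ε)
    (y : RestrictedAlg p' Q' ε') : Commute (f x) (g y) := by
  have hy (x : RestrictedGen) (y : RestrictedAlg p' Q' ε') :
      Commute (f (gen p Q ε x)) (g y) := by
    have hmem : y ∈ Algebra.adjoin ℂ (Set.range (gen p' Q' ε')) := by
      rw [adjoin_range_gen]; trivial
    induction hmem using Algebra.adjoin_induction with
    | mem y hy => obtain ⟨y, rfl⟩ := hy; exact h x y
    | algebraMap r => rw [AlgHom.commutes]; exact Algebra.commute_algebraMap_right r _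
    | add y z _ _ hy hz => rw [map_add]; exact hy.add_right hz
    | mul y z _ _ hy hz => rw [map_mul]; exact hy.mul_right hz
  have hmem : x ∈ Algebra.adjoin ℂ (Set.range (gen p Q ε)) := by
    rw [adjoin_range_gen]; trivial
  induction hmem using Algebra.adjoin_induction with
  | mem x hx => obtain ⟨x, rfl⟩ := hx; exact hy x y
  | algebraMap r => rw [AlgHom.commutes]; exact Algebra.commute_algebraMap_left r _
  | add x z _ _ hx hz => rw [map_add]; exact hx.add_left hz
  | mul x z _ _ hx hz => rw [map_mul]; exact hx.mul_left hz

theorem pow_mul_pow_pow_eq {A : Type*} [Ring A] [Algebra ℂ A] {p p' a b n : ℕ} {ε : ℂ} {k k' : A}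
    (hε : ε ^ 2 = 1) (hk : k ^ p = algebraMap ℂ A ε) (hk' : k' ^ p' = algebraMap ℂ A ε)
    (hcomm : Commute k k') (hab : a * p' + b * p = 1 + 2 * n * p) :
    (k ^ a * k' ^ b) ^ p' = k := by
  rw [(hcomm.pow_pow a b).mul_pow, ← pow_mul, ← pow_mul, mul_comm b, pow_mul k', hk', ← hk,
    ← pow_mul, ← pow_add, mul_comm p b, hab, pow_add, pow_one, mul_comm _ p, pow_mul, hk, pow_mul,
    ← map_pow, hε, map_one, one_pow, mul_one]

/-- The factor of the quantum group on which `K ^ (pp * pm)` acts by `ε`. -/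
abbrev QGFactor (pp pm : ℕ) (ε : ℂ) : Type :=
  RestrictedAlg pp (rootOfUnity pp ^ pm) ε ⊗[ℂ] RestrictedAlg pm (rootOfUnity pm ^ pp) ε

namespace QG

variable {pp pm : ℕ} {ε : ℂ}

theorem exists_mul_add_mul_eq (hco : Nat.Coprime pp pm) :
    ∃ a b n : ℕ, a * pm + b * pp = 1 + 2 * (n * pm) * pp := by
  obtain ⟨u, v, huv⟩ := Nat.isCoprime_iff_coprime.2 hco
  rcases Nat.eq_zero_or_pos pp with rfl | hpp
  · exact ⟨1, 0, 0, by simpa using hco⟩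
  rcases Nat.eq_zero_or_pos pm with rfl | hpm
  · exact ⟨0, 1, 0, by simpa using hco⟩
  set t := u.natAbs + v.natAbs
  have ha : 0 ≤ v + 2 * pp * t := by
    have : (t : ℤ) ≤ pp * t := le_mul_of_one_le_left (by positivity) (by exact_mod_cast hpp)
    have : (t : ℤ) = |u| + |v| := by simp [t]
    have := abs_nonneg u
    have := neg_abs_le v
    linarith
  have hb : 0 ≤ u + 2 * pm * t := by
    have : (t : ℤ) ≤ pm * t := le_mul_of_one_le_left (by positivity) (by exact_mod_cast hpm)
    have : (t : ℤ) = |u| + |v| := by simp [t]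
    have := abs_nonneg v
    have := neg_abs_le u
    linarith
  refine ⟨(v + 2 * pp * t).toNat, (u + 2 * pm * t).toNat, 2 * t, ?_⟩
  zify
  rw [Int.toNat_of_nonneg ha, Int.toNat_of_nonneg hb]
  linear_combination huv

theorem exists_toFactor (hpp : pp ≠ 0) (hpm : pm ≠ 0) (hco : Nat.Coprime pp pm)
    (hε : ε ^ 2 = 1) :
    ∃ (f : QG pp pm →ₐ[ℂ] QGFactor pp pm ε) (a b : ℕ),
      f (gen pp pm .Ep) = RestrictedAlg.gen pp _ ε .E ⊗ₜ 1 ∧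
      f (gen pp pm .Fp) = RestrictedAlg.gen pp _ ε .F ⊗ₜ 1 ∧
      f (gen pp pm .K ^ pm) = RestrictedAlg.gen pp _ ε .k ⊗ₜ 1 ∧
      f (gen pp pm .Em) = 1 ⊗ₜ RestrictedAlg.gen pm _ ε .E ∧
      f (gen pp pm .Fm) = 1 ⊗ₜ RestrictedAlg.gen pm _ ε .F ∧
      f (gen pp pm .K ^ pp) = 1 ⊗ₜ RestrictedAlg.gen pm _ ε .k ∧
      gen pp pm .K = (gen pp pm .K ^ pm) ^ a * (gen pp pm .K ^ pp) ^ b := by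
  obtain ⟨a, b, n, hab⟩ := exists_mul_add_mul_eq hco
  have h₁ := (RestrictedAlg.restrictedRel (p := pp) (Q := rootOfUnity pp ^ pm) (ε := ε)).tmul_one
    (RestrictedAlg pm (rootOfUnity pm ^ pp) ε)
  have h₂ := (RestrictedAlg.restrictedRel (p := pm) (Q := rootOfUnity pm ^ pp) (ε := ε)).one_tmul
    (RestrictedAlg pp (rootOfUnity pp ^ pm) ε)
  have hc (x : RestrictedAlg pp (rootOfUnity pp ^ pm) ε)
      (y : RestrictedAlg pm (rootOfUnity pm ^ pp) ε) := commute_tmul_one_one_tmul x y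
  have hpow₁ := pow_mul_pow_pow_eq hε h₁.k_pow h₂.k_pow (hc _ _) hab
  have hpow₂ := pow_mul_pow_pow_eq (a := b) (b := a) (n := n * pp) hε h₂.k_pow h₁.k_pow
    (hc _ _).symm (by rw [add_comm, hab]; ring)
  have ha : a * pm ≡ 1 [MOD pp] := by
    have h := congrArg (· % pp) hab
    simpa [Nat.ModEq] using h
  have hb : b * pp ≡ 1 [MOD pm] := by
    have h := congrArg (· % pm) hab
    rw [show 2 * (n * pm) * pp = 2 * n * pp * pm by ring] at h
    simpa [Nat.ModEq] using h
  have hr₁ := h₁.qgHalfRel (a := a) hpp ha ((hc _ _).symm.pow_left b)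
    ((hc _ _).symm.pow_left b) hpow₁
  have hr₂ := h₂.qgHalfRel (a := b) hpm hb ((hc _ _).pow_left a) ((hc _ _).pow_left a) hpow₂
  rw [((hc _ _).symm.pow_pow b a).eq] at hr₂ hpow₂
  have hK : ((RestrictedAlg.gen pp _ ε .k ⊗ₜ 1) ^ a * (1 ⊗ₜ RestrictedAlg.gen pm _ ε .k) ^ b :
        QGFactor pp pm ε) ^ (2 * pp * pm) = 1 := by
    rw [mul_comm, pow_mul, hpow₁, mul_comm, pow_mul, h₁.k_pow, ← map_pow, hε, map_one]
  refine ⟨lift hr₁ hr₂ ⟨hc _ _, hc _ _, hc _ _, hc _ _⟩ hK, a, b, ?_, ?_, ?_, ?_, ?_, ?_, ?_⟩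
  · rw [lift_gen]; rfl
  · rw [lift_gen]; rfl
  · rw [map_pow, lift_gen]; exact hpow₁
  · rw [lift_gen]; rfl
  · rw [lift_gen]; rfl
  · rw [map_pow, lift_gen]; exact hpow₂
  · rw [← pow_mul, ← pow_mul, ← pow_add, mul_comm pm, mul_comm pp, hab, pow_add, pow_one,
      show 2 * (n * pm) * pp = 2 * pp * pm * n by ring, pow_mul, gen_K_pow, one_pow, mul_one]

end QG

theorem exists_algHom_eq_zero_iff_mul_eq_zero.{u} {A : Type u} [Ring A] [Algebra ℂ A] {c : A}
    (hc : ∀ x, Commute c x) : ∃ (B : Type u) (_ : Ring B) (_ : Algebra ℂ B) (π : A →ₐ[ℂ] B),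
      ∀ x, π x = 0 ↔ c * x = 0 := by
  let I : Ideal A :=
    { carrier := {x | c * x = 0}
      add_mem' := fun {x y} hx hy => by
        change c * x = 0 at hx
        change c * y = 0 at hy
        change c * (x + y) = 0
        rw [mul_add, hx, hy, add_zero]
      zero_mem' := mul_zero c
      smul_mem' := fun a x hx => by
        change c * x = 0 at hx
        change c * (a • x) = 0
        rw [smul_eq_mul, (hc a).left_comm, hx, mul_zero] }
  have hI (x : A) : x ∈ I ↔ c * x = 0 := Iff.rfl
  have : I.IsTwoSided := ⟨fun {x} y hx => by rw [hI] at hx ⊢; rw [← mul_assoc, hx, zero_mul]⟩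
  exact ⟨A ⧸ I, inferInstance, inferInstance, Ideal.Quotient.mkₐ ℂ I, fun x =>
    Ideal.Quotient.eq_zero_iff_mem⟩

namespace QG

variable {pp pm : ℕ} {ε : ℂ}

theorem commute_gen_K_pow (hpp : pp ≠ 0) (hpm : pm ≠ 0) (x : QG pp pm) :
    Commute (gen pp pm .K ^ (pp * pm)) x := by
  have hgen (x : QGGen) : Commute (gen pp pm .K ^ (pp * pm)) (gen pp pm x) := by
    cases x with
    | Ep => rw [pow_mul]; exact (halfRel_plus.commute_E hpp).pow_left pm
    | Fp => rw [pow_mul]; exact (halfRel_plus.commute_F hpp).pow_left pm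
    | Em => rw [mul_comm, pow_mul]; exact (halfRel_minus.commute_E hpm).pow_left pp
    | Fm => rw [mul_comm, pow_mul]; exact (halfRel_minus.commute_F hpm).pow_left pp
    | K => exact Commute.pow_self _ _
  have hmem : x ∈ Algebra.adjoin ℂ (Set.range (gen pp pm)) := by
    rw [adjoin_range_gen]; trivial
  induction hmem using Algebra.adjoin_induction with
  | mem x hx => obtain ⟨x, rfl⟩ := hx; exact hgen x
  | algebraMap r => exact Algebra.commute_algebraMap_right r _
  | add x y _ _ hx hy => exact hx.add_right hy
  | mul x y _ _ hx hy => exact hx.mul_right hy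

/-- The quantum group maps onto its factors, and the kernel of this map is killed by a central
element. -/
theorem exists_surjective_toFactor (hpp : pp ≠ 0) (hpm : pm ≠ 0) (hco : Nat.Coprime pp pm)
    (hε : ε ^ 2 = 1) :
    ∃ f : QG pp pm →ₐ[ℂ] QGFactor pp pm ε, Function.Surjective f ∧
      f (gen pp pm .K ^ (pp * pm)) = algebraMap ℂ _ ε ∧
      ∀ x, f x = 0 → (gen pp pm .K ^ (pp * pm) + algebraMap ℂ _ ε) * x = 0 := by
  obtain ⟨f, a, b, hEp, hFp, hKp, hEm, hFm, hKm, hK⟩ := exists_toFactor hpp hpm hco hε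
  refine ⟨f, ?_, ?_, fun x hx => ?_⟩
  · have hl (x : RestrictedAlg pp (rootOfUnity pp ^ pm) ε) :
        x ⊗ₜ[ℂ] (1 : RestrictedAlg pm (rootOfUnity pm ^ pp) ε) ∈ f.range := by
      have hmem : x ∈ Algebra.adjoin ℂ (Set.range (RestrictedAlg.gen pp _ ε)) := by
        rw [RestrictedAlg.adjoin_range_gen]; trivial
      induction hmem using Algebra.adjoin_induction with
      | mem x hx =>
        obtain ⟨_ | _ | _, rfl⟩ := hx
        exacts [⟨_, hEp⟩, ⟨_, hFp⟩, ⟨_, hKp⟩]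
      | algebraMap r => exact f.range.algebraMap_mem r
      | add x y _ _ hx hy => rw [TensorProduct.add_tmul]; exact add_mem hx hy
      | mul x y _ _ hx hy =>
        have := mul_mem hx hy
        rwa [Algebra.TensorProduct.tmul_mul_tmul, mul_one] at this
    have hr (x : RestrictedAlg pm (rootOfUnity pm ^ pp) ε) :
        (1 : RestrictedAlg pp (rootOfUnity pp ^ pm) ε) ⊗ₜ[ℂ] x ∈ f.range := by
      have hmem : x ∈ Algebra.adjoin ℂ (Set.range (RestrictedAlg.gen pm _ ε)) := by
        rw [RestrictedAlg.adjoin_range_gen]; trivial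
      induction hmem using Algebra.adjoin_induction with
      | mem x hx =>
        obtain ⟨_ | _ | _, rfl⟩ := hx
        exacts [⟨_, hEm⟩, ⟨_, hFm⟩, ⟨_, hKm⟩]
      | algebraMap r =>
        have := f.range.algebraMap_mem r
        rwa [Algebra.TensorProduct.algebraMap_apply'] at this
      | add x y _ _ hx hy => rw [TensorProduct.tmul_add]; exact add_mem hx hy
      | mul x y _ _ hx hy =>
        have := mul_mem hx hy
        rwa [Algebra.TensorProduct.tmul_mul_tmul, mul_one] at this
    intro t
    change t ∈ f.range
    induction t using TensorProduct.induction_on with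
    | zero => exact zero_mem _
    | add x y hx hy => exact add_mem hx hy
    | tmul x y =>
      have := mul_mem (hl x) (hr y)
      rwa [Algebra.TensorProduct.tmul_mul_tmul, mul_one, one_mul] at this
  · rw [mul_comm, pow_mul, map_pow, hKp, Algebra.TensorProduct.tmul_pow, one_pow,
      RestrictedAlg.restrictedRel.k_pow]
    rfl
  · have hcomm (x : QG pp pm) :
        Commute (gen pp pm .K ^ (pp * pm) + algebraMap ℂ (QG pp pm) ε) x :=
      (commute_gen_K_pow hpp hpm x).add_left (Algebra.commute_algebraMap_left ε x)
    obtain ⟨B, _, _, π, hπ⟩ := exists_algHom_eq_zero_iff_mul_eq_zero hcomm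
    rw [← hπ]
    have hz : π (gen pp pm .K) ^ (pp * pm) = algebraMap ℂ B ε := by
      rw [← map_pow, ← sub_eq_zero, ← AlgHom.commutes π, ← map_sub, hπ,
        ← ((Algebra.commute_algebraMap_right ε _).sq_sub_sq), ← map_pow, hε, map_one, ← pow_mul,
        show pp * pm * 2 = 2 * pp * pm by ring, gen_K_pow, sub_self]
    have h₁ := (halfRel_plus.map π).restrictedRel hz
    have h₂ := (halfRel_minus.map π).restrictedRel ((congrArg _ (mul_comm pm pp)).trans hz)
    have hKK : Commute (π (gen pp pm .K) ^ pm) (π (gen pp pm .K) ^ pp) := Commute.pow_pow_self _ _ _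
    have hc : ∀ x y, Commute (RestrictedAlg.lift h₁ x) (RestrictedAlg.lift h₂ y) := by
      refine RestrictedAlg.commute_of_commute_gen _ _ fun x y => ?_
      rw [RestrictedAlg.lift_gen, RestrictedAlg.lift_gen]
      cases x <;> cases y
      · exact pairsCommute.E_E.map π
      · exact pairsCommute.E_F.map π
      · exact ((halfRel_plus.map π).commute_E hpp).symm
      · exact pairsCommute.F_E.map π
      · exact pairsCommute.F_F.map π
      · exact ((halfRel_plus.map π).commute_F hpp).symm
      · exact (halfRel_minus.map π).commute_E hpm
      · exact (halfRel_minus.map π).commute_F hpm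
      · exact hKK
    let g : QGFactor pp pm ε →ₐ[ℂ] B := Algebra.TensorProduct.lift _ _ hc
    have hgl (y) : g (y ⊗ₜ 1) = RestrictedAlg.lift h₁ y := by simp [g]
    have hgr (y) : g (1 ⊗ₜ y) = RestrictedAlg.lift h₂ y := by simp [g]
    have hgf : g.comp f = π := by
      refine algHom_ext fun y => ?_
      rw [AlgHom.comp_apply]
      cases y with
      | Ep => rw [hEp, hgl, RestrictedAlg.lift_gen]; rfl
      | Fp => rw [hFp, hgl, RestrictedAlg.lift_gen]; rfl
      | Em => rw [hEm, hgr, RestrictedAlg.lift_gen]; rfl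
      | Fm => rw [hFm, hgr, RestrictedAlg.lift_gen]; rfl
      | K =>
        have h := congrArg (fun y => g (f y)) hK
        simp only [map_mul f, map_pow f (gen pp pm .K ^ pm), map_pow f (gen pp pm .K ^ pp), hKp,
          hKm, map_mul g, map_pow g, hgl, hgr, RestrictedAlg.lift_gen] at h
        refine h.trans ?_
        conv_rhs => rw [hK]
        simp [RestrictedAlg.values]
    rw [← hgf, AlgHom.comp_apply, hx, map_zero]

theorem exists_equiv_factors (hpp : pp ≠ 0) (hpm : pm ≠ 0) (hco : Nat.Coprime pp pm) :
    Nonempty (QG pp pm ≃ₐ[ℂ] QGFactor pp pm 1 × QGFactor pp pm (-1)) := by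
  obtain ⟨f, hf, hfz, hfk⟩ := exists_surjective_toFactor (ε := 1) hpp hpm hco (by norm_num)
  obtain ⟨g, hg, hgz, hgk⟩ := exists_surjective_toFactor (ε := -1) hpp hpm hco (by norm_num)
  refine ⟨AlgEquiv.ofBijective (f.prod g) ⟨?_, fun ⟨t, u⟩ => ?_⟩⟩
  · rw [injective_iff_map_eq_zero]
    intro x hx
    have h1 := hfk x (congrArg Prod.fst hx)
    have h2 := hgk x (congrArg Prod.snd hx)
    have h3 : (2 : ℂ) • x = 0 := by
      have h : (2 : ℂ) • x = (gen pp pm .K ^ (pp * pm) + algebraMap ℂ _ 1) * x -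
          (gen pp pm .K ^ (pp * pm) + algebraMap ℂ _ (-1)) * x := by
        rw [← sub_mul, map_neg, map_one, add_sub_add_left_eq_sub, sub_neg_eq_add, add_mul,
          one_mul, two_smul]
      rw [h, h1, h2, sub_zero]
    exact (smul_eq_zero.1 h3).resolve_left two_ne_zero
  · obtain ⟨x, rfl⟩ := hf t
    obtain ⟨y, rfl⟩ := hg u
    refine ⟨(2⁻¹ : ℂ) • ((1 + gen pp pm .K ^ (pp * pm)) * x + (1 - gen pp pm .K ^ (pp * pm)) * y),
      Prod.ext ?_ ?_⟩
    · change f _ = f x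
      rw [map_smul, map_add, map_mul, map_mul, map_add, map_sub, map_one, hfz, map_one, sub_self,
        zero_mul, add_zero, add_mul, one_mul, ← two_smul ℂ (f x), inv_smul_smul₀ two_ne_zero]
    · change g _ = g y
      rw [map_smul, map_add, map_mul, map_mul, map_add, map_sub, map_one, hgz, map_neg, map_one,
        add_neg_cancel, zero_mul, zero_add, sub_neg_eq_add, add_mul, one_mul,
        ← two_smul ℂ (g y), inv_smul_smul₀ two_ne_zero]

end QG

theorem finrank_center_tensorProduct {k A B : Type*} [Field k] [Ring A] [Ring B] [Algebra k A]
    [Algebra k B] (hA : FiniteDimensional k (Subalgebra.center k A))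
    (hB : FiniteDimensional k (Subalgebra.center k B)) :
    FiniteDimensional k (Subalgebra.center k (A ⊗[k] B)) ∧
      Module.finrank k (Subalgebra.center k (A ⊗[k] B)) =
        Module.finrank k (Subalgebra.center k A) * Module.finrank k (Subalgebra.center k B) := by
  obtain ⟨e⟩ := exists_centerTensorEquiv k A B
  exact ⟨e.finiteDimensional, by rw [← e.finrank_eq, Module.finrank_tensorProduct]⟩

theorem finrank_center_of_equiv_prod {k A B C : Type*} [Field k] [Ring A] [Ring B] [Ring C]
    [Algebra k A] [Algebra k B] [Algebra k C] (e : A ≃ₐ[k] B × C)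
    (hB : FiniteDimensional k (Subalgebra.center k B))
    (hC : FiniteDimensional k (Subalgebra.center k C)) :
    FiniteDimensional k (Subalgebra.center k A) ∧
      Module.finrank k (Subalgebra.center k A) =
        Module.finrank k (Subalgebra.center k B) + Module.finrank k (Subalgebra.center k C) := by
  obtain ⟨e₁⟩ := exists_centerEquiv e
  obtain ⟨e₂⟩ := exists_centerProdEquiv k B C
  exact ⟨(e₁.trans e₂).symm.finiteDimensional, by
    rw [(e₁.trans e₂).finrank_eq, Module.finrank_prod]⟩

theorem finrank_center_of_equiv_prod_tensorProduct {k A B C B' C' : Type*} [Field k] [Ring A]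
    [Ring B] [Ring C] [Ring B'] [Ring C'] [Algebra k A] [Algebra k B] [Algebra k C] [Algebra k B']
    [Algebra k C'] (e : A ≃ₐ[k] (B ⊗[k] C) × (B' ⊗[k] C'))
    (hB : FiniteDimensional k (Subalgebra.center k B))
    (hC : FiniteDimensional k (Subalgebra.center k C))
    (hB' : FiniteDimensional k (Subalgebra.center k B'))
    (hC' : FiniteDimensional k (Subalgebra.center k C')) :
    FiniteDimensional k (Subalgebra.center k A) ∧
      Module.finrank k (Subalgebra.center k A) =
        Module.finrank k (Subalgebra.center k B) * Module.finrank k (Subalgebra.center k C) +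
        Module.finrank k (Subalgebra.center k B') * Module.finrank k (Subalgebra.center k C') := by
  obtain ⟨h₁, h₂⟩ := finrank_center_tensorProduct hB hC
  obtain ⟨h₃, h₄⟩ := finrank_center_tensorProduct hB' hC'
  rw [← h₂, ← h₄]
  exact finrank_center_of_equiv_prod e h₁ h₃

/-- The center `Z` of `g_{p₊,p₋}` is a finite-dimensional complex vector space of
dimension `(3p₊ − 1)(3p₋ − 1)/2`. -/
theorem center_dim (pp pm : ℕ) (hpp : 2 ≤ pp) (hpm : 2 ≤ pm) (hco : Nat.Coprime pp pm) :
    FiniteDimensional ℂ (Subalgebra.center ℂ (QG pp pm)) ∧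
      Module.finrank ℂ (Subalgebra.center ℂ (QG pp pm)) =
        (3 * pp - 1) * (3 * pm - 1) / 2 := by
  obtain ⟨e⟩ := QG.exists_equiv_factors (pp := pp) (pm := pm) (by omega) (by omega) hco
  have hqp := isPrimitiveRoot_rootOfUnity_pow_sq (by omega) hco
  have hqm := isPrimitiveRoot_rootOfUnity_pow_sq (by omega) hco.symm
  have h1 : (1 : ℂ) ^ 2 = 1 := by norm_num
  have h2 : (-1 : ℂ) ^ 2 = 1 := by norm_num
  obtain ⟨hf, h⟩ := finrank_center_of_equiv_prod_tensorProduct e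
    (RestrictedAlg.finiteDimensional_center hpp hqp h1)
    (RestrictedAlg.finiteDimensional_center hpm hqm h1)
    (RestrictedAlg.finiteDimensional_center hpp hqp h2)
    (RestrictedAlg.finiteDimensional_center hpm hqm h2)
  refine ⟨hf, ?_⟩
  rw [h]
  have hp := RestrictedAlg.finrank_center_add_finrank_center hpp hqp
  have hm := RestrictedAlg.finrank_center_add_finrank_center hpm hqm
  rw [← hp, ← hm, Nat.add_sub_cancel, Nat.add_sub_cancel]
  refine (Nat.div_eq_of_eq_mul_right two_pos ?_).symm
  have hodd : Odd pp ∨ Odd pm := by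
    by_contra! h
    rw [Nat.not_odd_iff_even, Nat.not_odd_iff_even] at h
    have := Nat.dvd_gcd h.1.two_dvd h.2.two_dvd
    rw [hco] at this
    omega
  rcases hodd with h | h
  · have h1 := RestrictedAlg.finrank_center_of_odd hpp h hqp (Or.inl rfl)
    have h2 := RestrictedAlg.finrank_center_of_odd hpp h hqp (Or.inr rfl)
    have h3 := Nat.eq_of_mul_eq_mul_left two_pos (Nat.add_right_cancel (h1.trans h2.symm))
    rw [h3]
    ring
  · have h1 := RestrictedAlg.finrank_center_of_odd hpm h hqm (Or.inl rfl)
    have h2 := RestrictedAlg.finrank_center_of_odd hpm h hqm (Or.inr rfl)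
    have h3 := Nat.eq_of_mul_eq_mul_left two_pos (Nat.add_right_cancel (h1.trans h2.symm))
    rw [h3]
    ring
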